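/- Let d ≥ 3. There exist k ∈ ℕ, rotations g_1, …, g_k ∈ SO(d), and ε > 0 such that for every x ∈ ℝ^d with ‖x‖ = 1, every n ∈ ℕ and every δ > 0, N_δ(Gⁿ(x)) ≥ min{(1+ε)ⁿ, ε δ^{−(d−1)}}, where Gⁿ(x) = {g_{i_1}(g_{i_2}(⋯ g_{i_n}(x)⋯)) : (i_1,…,i_n) ∈ {1,…,k}ⁿ}. -/

import Mathlib

/-- The number of cubes from the `δ`-mesh on `ℝ^d` (products of half-open intervals
`[aδ, (a+1)δ)`, `a ∈ ℤ`) that intersect `E`. -/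
noncomputable def meshCount (d : ℕ) (δ : ℝ) (E : Set (Fin d → ℝ)) : ℕ :=
  Set.ncard {a : Fin d → ℤ | ∃ x ∈ E, ∀ i, (a i : ℝ) * δ ≤ x i ∧ x i < ((a i : ℝ) + 1) * δ}

namespace BoxCounting

/-! ### Representations as a sum of two squares -/

/-- The Gaussian integers of norm `n`. -/
def gaussianSphere (n : ℕ) : Set GaussianInt := {z | z.norm = n}

lemma gaussianSphere_finite (n : ℕ) : (gaussianSphere n).Finite := by
  have h : gaussianSphere n ⊆
      (fun p : ℤ × ℤ => (⟨p.1, p.2⟩ : GaussianInt)) ''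
        (Set.Icc (-(n : ℤ)) n ×ˢ Set.Icc (-(n : ℤ)) n) := by
    rintro ⟨x, y⟩ hz
    simp only [gaussianSphere, Set.mem_ofPred_eq, Zsqrtd.norm_def] at hz
    refine ⟨(x, y), ?_, rfl⟩
    simp only [Set.mem_prod, Set.mem_Icc]
    refine ⟨⟨?_, ?_⟩, ?_, ?_⟩ <;> nlinarith [sq_nonneg (x - 1), sq_nonneg (x + 1),
      sq_nonneg (y - 1), sq_nonneg (y + 1), sq_nonneg x, sq_nonneg y]
  exact (((Set.finite_Icc _ _).prod (Set.finite_Icc _ _)).image _).subset h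

lemma gaussianSphere_one_ncard_le : (gaussianSphere 1).ncard ≤ 9 := by
  have h : gaussianSphere 1 ⊆
      (((Finset.Icc (-1 : ℤ) 1 ×ˢ Finset.Icc (-1 : ℤ) 1).image
        (fun p : ℤ × ℤ => (⟨p.1, p.2⟩ : GaussianInt)) : Finset GaussianInt) :
          Set GaussianInt) := by
    rintro ⟨x, y⟩ hz
    simp only [gaussianSphere, Set.mem_ofPred_eq, Zsqrtd.norm_def] at hz
    simp only [Finset.coe_image, Finset.coe_product, Finset.coe_Icc, Set.mem_image,
      Set.mem_prod, Set.mem_Icc]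
    have hz' : x * x + y * y = 1 := by push_cast at hz; linarith
    have hx : x ^ 2 ≤ 1 := by nlinarith [sq_nonneg y]
    have hy : y ^ 2 ≤ 1 := by nlinarith [sq_nonneg x]
    exact ⟨(x, y), ⟨abs_le.1 ((sq_le_one_iff_abs_le_one x).1 hx),
      abs_le.1 ((sq_le_one_iff_abs_le_one y).1 hy)⟩, rfl⟩
  calc (gaussianSphere 1).ncard ≤ _ := Set.ncard_le_ncard h (Finset.finite_toSet _)
    _ = _ := Set.ncard_coe_finset _
    _ ≤ _ := Finset.card_image_le
    _ = 9 := by simp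

lemma exists_factor_of_split {p : ℕ} [hp : Fact p.Prime] {a b : ℕ} (hab : a ^ 2 + b ^ 2 = p)
    (k m : ℕ) (z : GaussianInt) (hz : z.norm = ((p ^ k * m : ℕ) : ℤ)) :
    ∃ i ≤ k, ∃ z' : GaussianInt, z'.norm = m ∧
      z = (⟨a, b⟩ : GaussianInt) ^ i * (star (⟨a, b⟩ : GaussianInt)) ^ (k - i) * z' := by
  set π : GaussianInt := ⟨a, b⟩ with hπ
  have hN : π.norm = p := by
    rw [Zsqrtd.norm_def, ← hab]; push_cast; simp [hπ]; ring
  have hNs : (star π).norm = p := by rw [Zsqrtd.norm_conj, hN]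
  have hirr : Irreducible π := by
    refine ⟨fun hu => ?_, fun x y hxy => ?_⟩
    · have := (Zsqrtd.norm_eq_one_iff' (by norm_num) π).2 hu
      rw [hN] at this
      exact hp.1.one_lt.ne' (by exact_mod_cast this)
    · have h : x.norm.natAbs * y.norm.natAbs = p := by
        rw [← Int.natAbs_mul, ← Zsqrtd.norm_mul, ← hxy, hN]; simp
      rcases (Nat.dvd_prime hp.1).1 (Dvd.intro _ h) with h1 | h1
      · exact Or.inl (Zsqrtd.norm_eq_one_iff.1 h1)
      · right
        refine Zsqrtd.norm_eq_one_iff.1 ?_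
        rw [h1] at h
        exact Nat.eq_of_mul_eq_mul_left hp.1.pos (by simpa using h)
  have hprime : Prime π := hirr.prime
  induction k generalizing z with
  | zero => exact ⟨0, le_rfl, z, by simpa using hz, by simp⟩
  | succ k ih =>
    have hdvd : π ∣ z * star z := by
      rw [← Zsqrtd.norm_eq_mul_conj, hz]
      have : ((p : ℕ) : GaussianInt) = π * star π := by
        rw [← Zsqrtd.norm_eq_mul_conj, hN]; simp
      refine Dvd.intro (star π * ((p ^ k * m : ℕ) : GaussianInt)) ?_
      rw [← mul_assoc, ← this]; push_cast; ring
    have key : ∀ ϖ w : GaussianInt, ϖ.norm = p → z = ϖ * w → w.norm = ((p ^ k * m : ℕ) : ℤ) := by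
      intro ϖ w h1 h2
      have h3 : (p : ℤ) * w.norm = p * ((p ^ k * m : ℕ) : ℤ) := by
        rw [← h1, ← Zsqrtd.norm_mul, ← h2, hz, h1]; push_cast; ring
      exact mul_left_cancel₀ (by exact_mod_cast hp.1.ne_zero) h3
    rcases hprime.dvd_or_dvd hdvd with ⟨w, hw⟩ | ⟨w, hw⟩
    · obtain ⟨i, hi, z', hz', hwz⟩ := ih w (key _ _ hN hw)
      refine ⟨i + 1, by omega, z', hz', ?_⟩
      rw [hw, hwz, show k + 1 - (i + 1) = k - i by omega]; ring
    · have hw' : z = star π * star w := by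
        have := congrArg star hw
        simpa [mul_comm] using this
      obtain ⟨i, hi, z', hz', hwz⟩ := ih (star w) (key _ _ hNs hw')
      refine ⟨i, by omega, z', hz', ?_⟩
      rw [hw', hwz, show k + 1 - i = k - i + 1 by omega]; ring

lemma exists_factor_of_inert {p : ℕ} [hp : Fact p.Prime] (hp3 : p % 4 = 3)
    (k m : ℕ) (hm : ¬ p ∣ m) (z : GaussianInt) (hz : z.norm = ((p ^ k * m : ℕ) : ℤ)) :
    ∃ z' : GaussianInt, z'.norm = m ∧ z = (p : GaussianInt) ^ (k / 2) * z' := by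
  have hprime := GaussianInt.prime_of_nat_prime_of_mod_four_eq_three p hp3
  have hdvd : ∀ (k : ℕ) (z : GaussianInt), z.norm = ((p ^ (k + 1) * m : ℕ) : ℤ) →
      ∃ w : GaussianInt, z = p * w ∧ (p : ℤ) * w.norm = ((p ^ k * m : ℕ) : ℤ) := by
    intro k z hz
    have h : (p : GaussianInt) ∣ z * star z := by
      rw [← Zsqrtd.norm_eq_mul_conj, hz]
      refine Dvd.intro ((p ^ k * m : ℕ) : GaussianInt) ?_
      push_cast; ring
    have h' : (p : GaussianInt) ∣ z := by
      rcases hprime.dvd_or_dvd h with h | ⟨w, hw⟩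
      · exact h
      · refine ⟨star w, ?_⟩
        have := congrArg star hw
        simpa [mul_comm] using this
    obtain ⟨w, hw⟩ := h'
    refine ⟨w, hw, ?_⟩
    have h3 : (p : ℤ) * (p * w.norm) = p * ((p ^ k * m : ℕ) : ℤ) := by
      rw [hw, Zsqrtd.norm_mul, Zsqrtd.norm_natCast] at hz
      rw [← mul_assoc, hz]; push_cast; ring
    exact mul_left_cancel₀ (by exact_mod_cast hp.1.ne_zero) h3
  induction k using Nat.strong_induction_on generalizing z with
  | _ k ih =>
    match k, ih, hz with
    | 0, _, hz => exact ⟨z, by simpa using hz, by simp⟩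
    | 1, _, hz =>
      obtain ⟨w, -, hw⟩ := hdvd 0 z hz
      refine absurd ?_ hm
      have : (p : ℤ) ∣ (m : ℤ) := ⟨w.norm, by rw [hw]; simp⟩
      exact_mod_cast this
    | k + 2, ih, hz =>
      obtain ⟨w, hw, hwn⟩ := hdvd (k + 1) z hz
      have hwn' : w.norm = ((p ^ k * m : ℕ) : ℤ) := by
        refine mul_left_cancel₀ (a := (p : ℤ)) (by exact_mod_cast hp.1.ne_zero) ?_
        rw [hwn]; push_cast; ring
      obtain ⟨z', hz', hwz⟩ := ih k (by omega) w hwn'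
      refine ⟨z', hz', ?_⟩
      rw [hw, hwz, show (k + 2) / 2 = k / 2 + 1 by omega]; ring

lemma gaussianSphere_ncard_prime_pow_mul_le {p : ℕ} (hp : p.Prime) (k m : ℕ) (hm : ¬ p ∣ m) :
    (gaussianSphere (p ^ k * m)).ncard ≤ (k + 1) * (gaussianSphere m).ncard := by
  have : Fact p.Prime := ⟨hp⟩
  obtain ⟨φ, hφ⟩ : ∃ φ : ℕ → GaussianInt, ∀ z ∈ gaussianSphere (p ^ k * m),
      ∃ i ≤ k, ∃ z' ∈ gaussianSphere m, z = φ i * z' := by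
    by_cases h3 : p % 4 = 3
    · refine ⟨fun _ => (p : GaussianInt) ^ (k / 2), fun z hz => ?_⟩
      obtain ⟨z', h1, h2⟩ := exists_factor_of_inert h3 k m hm z hz
      exact ⟨0, Nat.zero_le _, z', h1, h2⟩
    · obtain ⟨a, b, hab⟩ := Nat.Prime.sq_add_sq h3
      refine ⟨fun i => (⟨a, b⟩ : GaussianInt) ^ i * (star (⟨a, b⟩ : GaussianInt)) ^ (k - i),
        fun z hz => ?_⟩
      obtain ⟨i, hi, z', h1, h2⟩ := exists_factor_of_split hab k m z hz
      exact ⟨i, hi, z', h1, h2⟩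
  classical
  set F := (gaussianSphere_finite m).toFinset with hF
  have hsub : gaussianSphere (p ^ k * m) ⊆
      (((Finset.range (k + 1) ×ˢ F).image fun q => φ q.1 * q.2 : Finset GaussianInt) :
        Set GaussianInt) := by
    intro z hz
    obtain ⟨i, hi, z', h1, h2⟩ := hφ z hz
    simp only [Finset.coe_image, Set.mem_image, Finset.mem_coe, Finset.mem_product,
      Finset.mem_range, Prod.exists]
    exact ⟨i, z', ⟨by omega, by simpa [hF] using h1⟩, h2.symm⟩
  calc (gaussianSphere (p ^ k * m)).ncard ≤ _ := Set.ncard_le_ncard hsub (Finset.finite_toSet _)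
    _ = _ := Set.ncard_coe_finset _
    _ ≤ _ := Finset.card_image_le
    _ = (k + 1) * (gaussianSphere m).ncard := by
      rw [Finset.card_product, Finset.card_range, hF,
        Set.ncard_eq_toFinset_card _ (gaussianSphere_finite m)]

/-- The divisor bound for representations as a sum of two squares. -/
lemma gaussianSphere_ncard_le {ε : ℝ} (hε : 0 < ε) :
    ∃ D : ℝ, 0 < D ∧ ∀ n : ℕ, n ≠ 0 → ((gaussianSphere n).ncard : ℝ) ≤ D * (n : ℝ) ^ ε := by
  obtain ⟨P, hP⟩ : ∃ P : ℕ, ∀ p : ℕ, P ≤ p → (2 : ℝ) ≤ (p : ℝ) ^ ε := by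
    have := (tendsto_rpow_atTop hε).comp tendsto_natCast_atTop_atTop
    obtain ⟨P, hP⟩ := Filter.eventually_atTop.1 (this.eventually_ge_atTop 2)
    exact ⟨P, hP⟩
  have hx : (0 : ℝ) < 2 ^ ε - 1 := by
    have := Real.one_lt_rpow (x := 2) (by norm_num) hε
    linarith
  set x : ℝ := 2 ^ ε - 1 with hxdef
  set C : ℝ := 1 + 1 / x with hC
  have hC1 : 1 ≤ C := by rw [hC]; have : 0 < 1 / x := by positivity
                         linarith
  have hCk : ∀ k : ℕ, (k : ℝ) + 1 ≤ C * ((2 : ℝ) ^ ε) ^ k := by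
    intro k
    have h1 := one_add_mul_le_pow (a := x) (by linarith) k
    rw [show (1 : ℝ) + x = 2 ^ ε by rw [hxdef]; ring] at h1
    have h2 : (k : ℝ) + 1 ≤ C * (1 + k * x) := by
      rw [hC]
      have : (1 + 1 / x) * (1 + k * x) = 1 + k + k * x + 1 / x := by field_simp; ring
      rw [this]
      have : 0 < 1 / x := by positivity
      have : 0 ≤ k * x := by positivity
      linarith
    exact h2.trans (by gcongr)
  let c : ℕ → ℝ := fun p => if p < P then C else 1
  have hc1 : ∀ p, 1 ≤ c p := by
    intro p; simp only [c]; split_ifs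
    · exact hC1
    · exact le_rfl
  have hcp : ∀ p k : ℕ, p.Prime → (k : ℝ) + 1 ≤ c p * ((p : ℝ) ^ ε) ^ k := by
    intro p k hp
    simp only [c]
    split_ifs with h
    · refine (hCk k).trans ?_
      have : (2 : ℝ) ≤ p := by exact_mod_cast hp.two_le
      gcongr
    · rw [one_mul]
      have h2 := hP p (by omega)
      calc (k : ℝ) + 1 ≤ 2 ^ k := by
            have := Nat.lt_two_pow_self (n := k)
            exact_mod_cast this
        _ ≤ _ := by gcongr
  refine ⟨9 * ∏ _p ∈ Finset.range P, C, by positivity, ?_⟩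
  have main : ∀ n : ℕ, n ≠ 0 →
      ((gaussianSphere n).ncard : ℝ) ≤ 9 * (∏ p ∈ n.primeFactors, c p) * (n : ℝ) ^ ε := by
    intro n
    induction n using Nat.recOnPrimePow with
    | zero => exact fun h => absurd rfl h
    | one => intro _; simpa using gaussianSphere_one_ncard_le
    | prime_pow_mul a p k hp hpa hk ih =>
      intro hne
      have ha : a ≠ 0 := by rintro rfl; simp at hpa
      have hpf : (p ^ k * a).primeFactors = insert p a.primeFactors := by
        rw [Nat.primeFactors_mul (pow_ne_zero _ hp.ne_zero) ha, Nat.primeFactors_pow _ hk.ne',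
          hp.primeFactors]
        rfl
      have hnot : p ∉ a.primeFactors := fun h => hpa (Nat.dvd_of_mem_primeFactors h)
      rw [hpf, Finset.prod_insert hnot]
      have h1 : ((gaussianSphere (p ^ k * a)).ncard : ℝ) ≤
          (k + 1) * (gaussianSphere a).ncard := by
        exact_mod_cast gaussianSphere_ncard_prime_pow_mul_le hp k a hpa
      have hpow : ((p ^ k * a : ℕ) : ℝ) ^ ε = ((p : ℝ) ^ ε) ^ k * (a : ℝ) ^ ε := by
        push_cast
        rw [Real.mul_rpow (by positivity) (by positivity), ← Real.rpow_natCast,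
          ← Real.rpow_natCast, ← Real.rpow_mul (by positivity), ← Real.rpow_mul (by positivity),
          mul_comm (k : ℝ)]
      rw [hpow]
      have hpr : 0 ≤ ∏ q ∈ a.primeFactors, c q :=
        Finset.prod_nonneg fun q _ => zero_le_one.trans (hc1 q)
      calc _ ≤ (k + 1) * ((gaussianSphere a).ncard : ℝ) := h1
        _ ≤ (c p * ((p : ℝ) ^ ε) ^ k) * (9 * (∏ q ∈ a.primeFactors, c q) * (a : ℝ) ^ ε) := by
            have := hcp p k hp
            have := ih ha
            gcongr
        _ = _ := by ring
  intro n hn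
  refine (main n hn).trans ?_
  gcongr
  calc ∏ p ∈ n.primeFactors, c p = ∏ p ∈ n.primeFactors with p < P, C := by
        rw [Finset.prod_filter]
    _ ≤ ∏ _p ∈ Finset.range P, C := by
        rw [Finset.prod_const, Finset.prod_const]
        refine pow_le_pow_right₀ hC1 (Finset.card_le_card fun p hp => ?_)
        simpa using (Finset.mem_filter.1 hp).2

end BoxCounting

namespace BoxCounting

open scoped Quaternion

/-! ### Walks with the six quaternions `1 ± 2i`, `1 ± 2j`, `1 ± 2k` -/

/-- The six steps of the walk. -/
def step : Fin 6 → ℍ[ℤ] :=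
  ![⟨1, 2, 0, 0⟩, ⟨1, -2, 0, 0⟩, ⟨1, 0, 2, 0⟩, ⟨1, 0, -2, 0⟩, ⟨1, 0, 0, 2⟩, ⟨1, 0, 0, -2⟩]

/-- The product of the steps along a word. -/
def walk {L : ℕ} (w : Fin L → Fin 6) : ℍ[ℤ] := (List.ofFn fun i => step (w i)).prod

lemma walk_zero (w : Fin 0 → Fin 6) : walk w = 1 := by simp [walk]

lemma walk_cons {L : ℕ} (s : Fin 6) (w : Fin L → Fin 6) :
    walk (Fin.cons s w : Fin (L + 1) → Fin 6) = step s * walk w := by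
  simp [walk, List.ofFn_succ]

lemma normSq_step (s : Fin 6) : Quaternion.normSq (step s) = 5 := by
  rw [Quaternion.normSq_def']
  fin_cases s <;> simp [step]

lemma normSq_walk {L : ℕ} (w : Fin L → Fin 6) : Quaternion.normSq (walk w) = 5 ^ L := by
  induction L with
  | zero => simp [walk_zero]
  | succ L ih =>
    rw [← Fin.cons_self_tail w, walk_cons, map_mul, normSq_step, ih, pow_succ']

lemma sum_words_succ {M : Type*} [AddCommMonoid M] {L : ℕ} (f : (Fin (L + 1) → Fin 6) → M) :
    ∑ w, f w = ∑ s, ∑ w, f (Fin.cons s w) := by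
  rw [← Fintype.sum_prod_type']
  exact (Fintype.sum_equiv (Fin.consEquiv fun _ => Fin 6) _ _ fun _ => rfl).symm

/-- Upper bounds for the number of words of length `L` whose product is a multiple of a given
primitive quaternion of norm `5 ^ m`. -/
def walkBound : ℕ → ℕ → ℕ
  | 0, 0 => 1
  | 0, _ + 1 => 0
  | L + 1, 0 => 6 * walkBound L 1
  | L + 1, m + 1 => walkBound L m + 5 * walkBound L (m + 2)

lemma walkBound_add_two_le (L m : ℕ) : walkBound L (m + 2) ≤ walkBound L m := by
  induction L generalizing m with
  | zero => simp [walkBound]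
  | succ L ih =>
    cases m with
    | zero => simp only [walkBound]; have := ih 1; simp at this; simp; omega
    | succ m => simp only [walkBound]; have := ih m; have := ih (m + 2); omega

lemma walkBound_mul_sqrt_pow_le (L m : ℕ) :
    (walkBound L m : ℝ) * √5 ^ m ≤ (2 * √5) ^ L := by
  have h5 : √5 * √5 = (5 : ℝ) := Real.mul_self_sqrt (by norm_num)
  have h0 : (0 : ℝ) ≤ √5 := Real.sqrt_nonneg _
  induction L generalizing m with
  | zero => cases m <;> simp [walkBound]
  | succ L ih =>
    cases m with
    | zero =>
      have := ih 1
      simp only [walkBound, pow_zero, pow_one, mul_one, pow_succ (2 * √5)] at *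
      push_cast
      have h1 : (walkBound L 1 : ℝ) * 5 ≤ (2 * √5) ^ L * √5 := by nlinarith
      have h2 : (0 : ℝ) ≤ walkBound L 1 := by positivity
      nlinarith
    | succ m =>
      have h1 := ih m
      have h2 := ih (m + 2)
      simp only [walkBound]
      push_cast
      calc ((walkBound L m : ℝ) + 5 * walkBound L (m + 2)) * √5 ^ (m + 1)
          = (walkBound L m * √5 ^ m + walkBound L (m + 2) * √5 ^ (m + 2)) * √5 := by
            rw [pow_add _ m 2, pow_two, h5, pow_succ]; ring
        _ ≤ ((2 * √5) ^ L + (2 * √5) ^ L) * √5 := by gcongr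
        _ = _ := by ring

lemma walkBound_two_mul_le (M m : ℕ) : (walkBound (2 * M) m : ℝ) ≤ 20 ^ M := by
  have h := walkBound_mul_sqrt_pow_le (2 * M) m
  have h5 : √5 ^ 2 = (5 : ℝ) := Real.sq_sqrt (by norm_num)
  have h1 : (1 : ℝ) ≤ √5 ^ m := one_le_pow₀ (by rw [Real.one_le_sqrt]; norm_num)
  rw [pow_mul, mul_pow, h5] at h
  norm_num at h
  have : (0 : ℝ) ≤ walkBound (2 * M) m := by positivity
  nlinarith

/-- The number of vertices at distance `m` from the root of the 6-regular tree. -/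
def treeSphere : ℕ → ℕ
  | 0 => 1
  | m + 1 => 6 * 5 ^ m

lemma sum_walkBound_mul_treeSphere_le (L M : ℕ) :
    ∑ m ∈ Finset.range M, walkBound L m * treeSphere m ≤ 6 ^ L := by
  induction L generalizing M with
  | zero =>
    cases M with
    | zero => simp
    | succ M => rw [Finset.sum_range_succ']; simp [walkBound, treeSphere]
  | succ L ih =>
    cases M with
    | zero => simp
    | succ M =>
      have key : ∀ M, 6 * walkBound L 1 + ∑ m ∈ Finset.range M,
          (walkBound L m + 5 * walkBound L (m + 2)) * treeSphere (m + 1) +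
          walkBound L M * treeSphere (M + 1) + walkBound L (M + 1) * treeSphere (M + 2) =
          6 * ∑ m ∈ Finset.range (M + 2), walkBound L m * treeSphere m := by
        intro M
        induction M with
        | zero => simp [Finset.sum_range_succ, treeSphere]; ring
        | succ M ih =>
          rw [Finset.sum_range_succ, Finset.sum_range_succ _ (M + 2), mul_add, ← ih]
          simp only [treeSphere]; ring
      rw [Finset.sum_range_succ']
      simp only [walkBound, treeSphere, mul_one] at *
      have h1 := key M
      have h2 := ih (M + 2)
      rw [pow_succ]
      omega

lemma sum_walkBound_mul_five_pow_le (L M : ℕ) :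
    ∑ m ∈ Finset.range M, walkBound L m * 5 ^ m ≤ 6 ^ L := by
  refine le_trans (Finset.sum_le_sum fun m _ => Nat.mul_le_mul_left _ ?_)
    (sum_walkBound_mul_treeSphere_le L M)
  cases m with
  | zero => simp [treeSphere]
  | succ m => simp only [treeSphere, pow_succ]; omega

lemma smul_quaternion_cancel {k : ℤ} (hk : k ≠ 0) {p q : ℍ[ℤ]} (h : k • p = k • q) : p = q := by
  have h1 := congrArg QuaternionAlgebra.re h
  have h2 := congrArg QuaternionAlgebra.imI h
  have h3 := congrArg QuaternionAlgebra.imJ h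
  have h4 := congrArg QuaternionAlgebra.imK h
  simp [hk] at h1 h2 h3 h4
  ext <;> assumption

lemma star_mul_mul_eq_normSq_smul (s q : ℍ[ℤ]) : star s * (s * q) = Quaternion.normSq s • q := by
  rw [← mul_assoc, Quaternion.star_mul_self, ← Quaternion.coe_mul_eq_smul]

lemma mul_star_mul_eq_normSq_smul (s q : ℍ[ℤ]) : s * (star s * q) = Quaternion.normSq s • q := by
  rw [← mul_assoc, Quaternion.self_mul_star, ← Quaternion.coe_mul_eq_smul]

/-- A quaternion not divisible by 5. -/
def IsPrimitive (q : ℍ[ℤ]) : Prop := ∀ r : ℍ[ℤ], q ≠ (5 : ℤ) • r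

lemma step_eq_of_dvd {q : ℍ[ℤ]} (hq : IsPrimitive q) {s t : Fin 6} {r r' : ℍ[ℤ]}
    (hs : star (step s) * q = (5 : ℤ) • r) (ht : star (step t) * q = (5 : ℤ) • r') : s = t := by
  by_contra hne
  have h1 : ∃ k : ℤ, k * Quaternion.normSq (step s - step t) = 16 := by
    revert hne
    have h8 : ∃ k : ℤ, k * 8 = 16 := ⟨2, rfl⟩
    have h16 : ∃ k : ℤ, k * 16 = 16 := ⟨1, rfl⟩
    rw [Quaternion.normSq_def']
    fin_cases s <;> fin_cases t <;> simp [step] <;> first | exact h8 | exact h16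
  obtain ⟨k, hk⟩ := h1
  have h2 : (5 : ℤ) • (k • ((step s - step t) * (r - r'))) = (16 : ℤ) • q := by
    rw [← hk, mul_smul, ← mul_star_mul_eq_normSq_smul, star_sub, sub_mul (star _), hs, ht,
      ← smul_sub, mul_smul_comm, smul_comm]
  refine hq (k • ((step s - step t) * (r - r')) - (3 : ℤ) • q) ?_
  rw [smul_sub, h2, smul_smul, ← sub_smul]; norm_num

lemma normSq_int_smul (k : ℤ) (q : ℍ[ℤ]) :
    Quaternion.normSq (k • q) = k ^ 2 * Quaternion.normSq q := by
  simp [Quaternion.normSq_def']; ring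

open Classical in
lemma card_walk_le (L m j : ℕ) (q : ℍ[ℤ]) (hq : IsPrimitive q)
    (hn : Quaternion.normSq q = 5 ^ m) :
    (Finset.univ.filter fun w : Fin L → Fin 6 => walk w = (5 ^ j : ℤ) • q).card ≤
      walkBound L m := by
  induction L generalizing m j q with
  | zero =>
    cases m with
    | zero => exact (Finset.card_le_univ _).trans (by simp [walkBound])
    | succ m =>
      rw [Finset.card_eq_zero.2]
      · simp
      · refine Finset.filter_eq_empty_iff.2 fun w _ h => ?_
        have h1 := congrArg Quaternion.normSq h
        rw [walk_zero, normSq_int_smul, hn, map_one, pow_succ (5 : ℤ) m] at h1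
        have : (5 : ℤ) ∣ 1 := ⟨(5 ^ j) ^ 2 * 5 ^ m, by rw [h1]; ring⟩
        norm_num at this
  | succ L ih =>
    rw [Finset.card_filter, sum_words_succ]
    simp only [walk_cons]
    simp only [← Finset.card_filter]
    have hmul : ∀ (s : Fin 6) (p : ℍ[ℤ]), step s * p = (5 ^ j : ℤ) • q →
        (5 : ℤ) • p = (5 ^ j : ℤ) • (star (step s) * q) := by
      intro s p h
      rw [← normSq_step s, ← star_mul_mul_eq_normSq_smul, h, normSq_step, mul_smul_comm]
    have hnr : ∀ s, Quaternion.normSq (star (step s) * q) = 5 ^ (m + 1) := by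
      intro s
      rw [map_mul, Quaternion.normSq_star, normSq_step, hn]; ring
    have hB : ∀ s, IsPrimitive (star (step s) * q) →
        (Finset.univ.filter fun w : Fin L → Fin 6 => step s * walk w = (5 ^ j : ℤ) • q).card ≤
          walkBound L (m + 1) := by
      intro s hs
      cases j with
      | zero =>
        rw [Finset.card_eq_zero.2]
        · simp
        · refine Finset.filter_eq_empty_iff.2 fun w _ h => ?_
          exact hs (walk w) (by simpa using (hmul s _ h).symm)
      | succ j =>
        refine (Finset.card_le_card fun w hw => ?_).trans
          (ih (m + 1) j (star (step s) * q) hs (hnr s))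
        simp only [Finset.mem_filter, Finset.mem_univ, true_and] at hw ⊢
        refine smul_quaternion_cancel (k := 5) (by norm_num) ?_
        rw [hmul s _ hw, smul_smul, pow_succ']
    have hA : ∀ s r, star (step s) * q = (5 : ℤ) • r → ∃ m', m = m' + 1 ∧
        (Finset.univ.filter fun w : Fin L → Fin 6 => step s * walk w = (5 ^ j : ℤ) • q).card ≤
          walkBound L m' := by
      intro s r hr
      have h1 := hnr s
      rw [hr, normSq_int_smul] at h1
      cases m with
      | zero =>
        have : (5 : ℤ) ∣ 1 := ⟨Quaternion.normSq r, by
          norm_num at h1; omega⟩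
        norm_num at this
      | succ m =>
        refine ⟨m, rfl, ?_⟩
        have hrn : Quaternion.normSq r = 5 ^ m := by
          refine mul_left_cancel₀ (a := (5 : ℤ) ^ 2) (by norm_num) ?_
          rw [h1]; ring
        have hrp : IsPrimitive r := by
          rintro r' rfl
          refine hq (step s * r') (smul_quaternion_cancel (k := 5) (by norm_num) ?_)
          rw [← normSq_step s, ← mul_star_mul_eq_normSq_smul, hr, normSq_step, mul_smul_comm,
            mul_smul_comm]
        refine (Finset.card_le_card fun w hw => ?_).trans (ih m j r hrp hrn)
        simp only [Finset.mem_filter, Finset.mem_univ, true_and] at hw ⊢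
        refine smul_quaternion_cancel (k := 5) (by norm_num) ?_
        rw [hmul s _ hw, hr, smul_comm]
    by_cases hex : ∃ s r, star (step s) * q = (5 : ℤ) • r
    · obtain ⟨s, r, hr⟩ := hex
      obtain ⟨m', rfl, hle⟩ := hA s r hr
      rw [← Finset.add_sum_erase _ _ (Finset.mem_univ s)]
      have h2 := Finset.sum_le_card_nsmul (Finset.univ.erase s) (fun s =>
        (Finset.univ.filter fun w : Fin L → Fin 6 => step s * walk w = (5 ^ j : ℤ) • q).card)
        (walkBound L (m' + 2)) (fun t ht => hB t fun r' hr' =>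
          (Finset.ne_of_mem_erase ht) (step_eq_of_dvd hq hr' hr))
      simp only [Finset.card_erase_of_mem (Finset.mem_univ _), Finset.card_univ,
        Fintype.card_fin, smul_eq_mul] at h2
      simp only [walkBound]
      exact add_le_add hle h2
    · have h2 := Finset.sum_le_card_nsmul Finset.univ (fun s =>
        (Finset.univ.filter fun w : Fin L → Fin 6 => step s * walk w = (5 ^ j : ℤ) • q).card)
        (walkBound L (m + 1)) (fun t _ => hB t fun r' hr' => hex ⟨t, r', hr'⟩)
      simp only [Finset.card_univ, Fintype.card_fin, smul_eq_mul] at h2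
      refine h2.trans ?_
      cases m with
      | zero => simp [walkBound]
      | succ m =>
        simp only [walkBound]
        have := walkBound_add_two_le L m
        rw [show m + 1 + 1 = m + 2 from rfl]
        omega

end BoxCounting

namespace BoxCounting

/-! ### Chebyshev polynomials of the second kind -/

/-- Values of the Chebyshev polynomials of the second kind. -/
def cheb (x : ℝ) : ℕ → ℝ
  | 0 => 1
  | 1 => 2 * x
  | n + 2 => 2 * x * cheb x (n + 1) - cheb x n

lemma cheb_pell (x : ℝ) (n : ℕ) :
    cheb x (n + 1) ^ 2 - 2 * x * cheb x (n + 1) * cheb x n + cheb x n ^ 2 = 1 := by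
  induction n with
  | zero => simp [cheb]; ring
  | succ n ih => rw [cheb]; linear_combination ih

lemma cheb_sq_mul_le (x : ℝ) (n : ℕ) : cheb x n ^ 2 * (1 - x ^ 2) ≤ 1 := by
  nlinarith [cheb_pell x n, sq_nonneg (cheb x (n + 1) - x * cheb x n)]

lemma abs_cheb_le {x : ℝ} (hx : x ^ 2 ≤ 1) (n : ℕ) : |cheb x n| ≤ n + 1 := by
  induction n with
  | zero => simp [cheb]
  | succ n ih =>
    have h1 : |cheb x (n + 1) - x * cheb x n| ≤ 1 := by
      rw [← sq_le_one_iff_abs_le_one]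
      nlinarith [cheb_pell x n, sq_nonneg (cheb x n), mul_nonneg (sq_nonneg (cheb x n))
        (sub_nonneg.2 hx)]
    have h2 : |x * cheb x n| ≤ n + 1 := by
      rw [abs_mul]
      have := (sq_le_one_iff_abs_le_one x).1 hx
      exact (mul_le_of_le_one_left (abs_nonneg _) this).trans ih
    have h3 := abs_add_le (cheb x (n + 1) - x * cheb x n) (x * cheb x n)
    rw [sub_add_cancel] at h3
    push_cast
    linarith

lemma cheb_pow_four_le {x : ℝ} (hx : x ^ 2 ≤ 1) (n : ℕ) : cheb x n ^ 4 ≤ (n + 1) ^ 4 := by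
  have h := pow_le_pow_left₀ (abs_nonneg _) (abs_cheb_le hx n) 4
  rwa [Even.pow_abs (by decide)] at h

lemma cheb_pow_four_mul_le {x : ℝ} (hx : x ^ 2 ≤ 1) (n : ℕ) :
    cheb x n ^ 4 * √(1 - x ^ 2) ^ 3 ≤ (n : ℝ) + 1 := by
  set s := √(1 - x ^ 2)
  have hs : s ^ 2 = 1 - x ^ 2 := Real.sq_sqrt (by linarith)
  have hs0 : 0 ≤ s := Real.sqrt_nonneg _
  have h1 : |cheb x n| * s ≤ 1 := by
    rw [← abs_of_nonneg hs0, ← abs_mul, ← sq_le_one_iff_abs_le_one, mul_pow, hs]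
    exact cheb_sq_mul_le x n
  have h2 := pow_le_one₀ (n := 3) (by positivity) h1
  calc cheb x n ^ 4 * s ^ 3 = (|cheb x n| * s) ^ 3 * |cheb x n| := by
        rw [← Even.pow_abs (by decide : Even 4) (cheb x n)]; ring
    _ ≤ 1 * ((n : ℝ) + 1) := by
        gcongr
        exact abs_cheb_le hx n
    _ = _ := one_mul _

lemma cheb_mul_sub_mul (x : ℝ) (m n : ℕ) :
    cheb x (m + 1) * cheb x (n + 1) - cheb x m * cheb x n = cheb x (m + n + 2) := by
  induction m generalizing n with
  | zero => simp [cheb]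
  | succ m ih =>
    have := ih (n + 1)
    rw [show m + 1 + n + 2 = m + (n + 1) + 2 by ring, ← this]
    simp only [cheb]; ring

lemma cheb_add_mul (x : ℝ) (b e : ℕ) :
    cheb x (b + e) * cheb x b = ∑ c ∈ Finset.range (b + 1), cheb x (e + 2 * c) := by
  induction b with
  | zero => simp [cheb]
  | succ b ih =>
    rw [Finset.sum_range_succ, ← ih, show e + 2 * (b + 1) = b + e + b + 2 by ring,
      ← cheb_mul_sub_mul, show b + 1 + e = b + e + 1 by ring]
    ring

lemma cheb_sq (x : ℝ) (l : ℕ) : cheb x l ^ 2 = ∑ i ∈ Finset.range (l + 1), cheb x (2 * i) := by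
  have := cheb_add_mul x l 0
  simp only [add_zero, zero_add] at this
  rw [pow_two, this]

lemma cheb_pow_four (x : ℝ) (l : ℕ) : cheb x l ^ 4 =
    ∑ i ∈ Finset.range (l + 1), ∑ j ∈ Finset.range (l + 1), cheb x (2 * i) * cheb x (2 * j) := by
  rw [← Finset.sum_mul_sum, ← cheb_sq]; ring

lemma cheb_mul_of_le (x : ℝ) {i j : ℕ} (h : i ≤ j) : cheb x (2 * i) * cheb x (2 * j) =
    ∑ c ∈ Finset.range (2 * i + 1), cheb x (2 * (j - i + c)) := by
  have := cheb_add_mul x (2 * i) (2 * (j - i))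
  rw [show 2 * i + 2 * (j - i) = 2 * j by omega] at this
  rw [mul_comm, this]
  simp only [mul_add]

section Averages

variable {ι : Type*} [Fintype ι] (x : ι → ℝ)

lemma sum_cheb_mul_of_le {i j : ℕ} (h : i ≤ j) : ∑ w, cheb (x w) (2 * i) * cheb (x w) (2 * j) =
    ∑ c ∈ Finset.range (2 * i + 1), ∑ w, cheb (x w) (2 * (j - i + c)) := by
  rw [Finset.sum_comm]
  exact Finset.sum_congr rfl fun w _ => cheb_mul_of_le _ h

lemma sum_cheb_pow_four (l : ℕ) : ∑ w, cheb (x w) l ^ 4 =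
    ∑ i ∈ Finset.range (l + 1), ∑ j ∈ Finset.range (l + 1),
      ∑ w, cheb (x w) (2 * i) * cheb (x w) (2 * j) := by
  simp only [cheb_pow_four]
  rw [Finset.sum_comm]
  exact Finset.sum_congr rfl fun i _ => Finset.sum_comm

/-- If all even Chebyshev sums are nonnegative then the fourth moment of the `l`-th one dominates
a quadratic multiple of the `2l`-th sum. -/
lemma mul_sum_cheb_le (hx : ∀ k, 0 ≤ ∑ w, cheb (x w) (2 * k)) (l : ℕ) :
    ((l : ℝ) + 1) ^ 2 / 2 * ∑ w, cheb (x w) (2 * l) ≤ ∑ w, cheb (x w) l ^ 4 := by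
  have hnn : ∀ i j, 0 ≤ ∑ w, cheb (x w) (2 * i) * cheb (x w) (2 * j) := by
    intro i j
    rcases le_total i j with h | h
    · rw [sum_cheb_mul_of_le x h]
      exact Finset.sum_nonneg fun c _ => hx _
    · simp_rw [mul_comm (cheb _ (2 * i))]
      rw [sum_cheb_mul_of_le x h]
      exact Finset.sum_nonneg fun c _ => hx _
  have hle' : ∀ i j, i ≤ j → j ≤ l → l ≤ i + j →
      ∑ w, cheb (x w) (2 * l) ≤ ∑ w, cheb (x w) (2 * i) * cheb (x w) (2 * j) := by
    intro i j hij hj hl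
    rw [sum_cheb_mul_of_le x hij]
    have := Finset.single_le_sum (f := fun c => ∑ w, cheb (x w) (2 * (j - i + c)))
      (fun c _ => hx _) (Finset.mem_range.2 (show l - (j - i) < 2 * i + 1 by omega))
    simpa only [show j - i + (l - (j - i)) = l by omega] using this
  have hle : ∀ i j, i ≤ l → j ≤ l → l ≤ i + j →
      ∑ w, cheb (x w) (2 * l) ≤ ∑ w, cheb (x w) (2 * i) * cheb (x w) (2 * j) := by
    intro i j hi hj hl
    rcases le_total i j with h | h
    · exact hle' i j h hj hl
    · simp_rw [mul_comm (cheb _ (2 * i))]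
      exact hle' j i h hi (by omega)
  rw [sum_cheb_pow_four]
  have hrow : ∀ i ∈ Finset.range (l + 1), ((i : ℝ) + 1) * ∑ w, cheb (x w) (2 * l) ≤
      ∑ j ∈ Finset.range (l + 1), ∑ w, cheb (x w) (2 * i) * cheb (x w) (2 * j) := by
    intro i hi
    rw [Finset.mem_range] at hi
    calc ((i : ℝ) + 1) * ∑ w, cheb (x w) (2 * l)
        = ∑ _j ∈ Finset.Icc (l - i) l, ∑ w, cheb (x w) (2 * l) := by
          rw [Finset.sum_const, Nat.card_Icc, nsmul_eq_mul,
            show l + 1 - (l - i) = i + 1 by omega]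
          push_cast; ring
      _ ≤ ∑ j ∈ Finset.Icc (l - i) l, ∑ w, cheb (x w) (2 * i) * cheb (x w) (2 * j) := by
          refine Finset.sum_le_sum fun j hj => ?_
          rw [Finset.mem_Icc] at hj
          exact hle i j (by omega) hj.2 (by omega)
      _ ≤ _ := by
          refine Finset.sum_le_sum_of_subset_of_nonneg (fun j hj => ?_) fun j _ _ => hnn i j
          rw [Finset.mem_Icc] at hj
          exact Finset.mem_range.2 (by omega)
  refine le_trans ?_ (Finset.sum_le_sum hrow)
  rw [← Finset.sum_mul]
  refine mul_le_mul_of_nonneg_right ?_ (hx l)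
  clear hrow hle hle' hnn
  induction l with
  | zero => norm_num
  | succ l ih => rw [Finset.sum_range_succ]; push_cast; nlinarith

end Averages

end BoxCounting

namespace BoxCounting

open scoped Quaternion

/-! ### Fourth moments of Chebyshev polynomials over quaternions of given norm -/

lemma gaussianSphere_ncard_le_of_le {ε : ℝ} (hε : 0 < ε) :
    ∃ D : ℝ, 0 < D ∧ ∀ r t : ℕ, r ≤ t → 1 ≤ t →
      ((gaussianSphere r).ncard : ℝ) ≤ D * (t : ℝ) ^ ε := by
  obtain ⟨D, hD, h⟩ := gaussianSphere_ncard_le hε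
  refine ⟨D + 1, by linarith, fun r t hrt ht => ?_⟩
  have ht1 : (1 : ℝ) ≤ t := by exact_mod_cast ht
  have ht2 : (1 : ℝ) ≤ (t : ℝ) ^ ε := Real.one_le_rpow ht1 hε.le
  rcases eq_or_ne r 0 with rfl | hr
  · have h0 : gaussianSphere 0 ⊆ {0} := by
      intro z hz
      simp only [gaussianSphere, Set.mem_ofPred_eq, Nat.cast_zero] at hz
      exact (Zsqrtd.norm_eq_zero_iff (by norm_num) z).1 hz
    have h1 := Set.ncard_le_ncard h0 (Set.finite_singleton _)
    rw [Set.ncard_singleton] at h1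
    have h2 : ((gaussianSphere 0).ncard : ℝ) ≤ 1 := by exact_mod_cast h1
    nlinarith
  · have h1 := h r hr
    have h2 : (r : ℝ) ^ ε ≤ (t : ℝ) ^ ε :=
      Real.rpow_le_rpow (by positivity) (by exact_mod_cast hrt) hε.le
    nlinarith

lemma card_fiber_le {ε : ℝ} (hε : 0 < ε) :
    ∃ D : ℝ, 0 < D ∧ ∀ (t : ℕ) (a : ℤ) (T : Finset ℍ[ℤ]), 1 ≤ t →
      (∀ q ∈ T, q.re = a ∧ Quaternion.normSq q = a ^ 2 + t) →
      (T.card : ℝ) ≤ D * √t * (t : ℝ) ^ ε := by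
  obtain ⟨D, hD, h⟩ := gaussianSphere_ncard_le_of_le hε
  refine ⟨3 * D, by positivity, fun t a T ht hT => ?_⟩
  have ht1 : (1 : ℝ) ≤ t := by exact_mod_cast ht
  have hs1 : (1 : ℝ) ≤ √t := Real.one_le_sqrt.2 ht1
  have hmem : ∀ q ∈ T, q.imI ^ 2 + q.imJ ^ 2 + q.imK ^ 2 = t := by
    intro q hq
    obtain ⟨h1, h2⟩ := hT q hq
    rw [Quaternion.normSq_def', h1] at h2
    linarith
  have hfib : ∀ z : ℤ, ((T.filter fun q => q.imK = z).card : ℝ) ≤ D * (t : ℝ) ^ ε := by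
    intro z
    rcases (T.filter fun q => q.imK = z).eq_empty_or_nonempty with he | ⟨q₀, hq₀⟩
    · rw [he]; simp; positivity
    rw [Finset.mem_filter] at hq₀
    have h0 := hmem q₀ hq₀.1
    rw [hq₀.2] at h0
    have hz : z ^ 2 ≤ t := by nlinarith [sq_nonneg q₀.imI, sq_nonneg q₀.imJ]
    obtain ⟨r, hr⟩ := Int.eq_ofNat_of_zero_le (sub_nonneg.2 hz)
    refine le_trans ?_ (h r t (by have := sq_nonneg z; omega) ht)
    have := Set.ncard_le_ncard_of_injOn (s := ((T.filter fun q => q.imK = z : Finset ℍ[ℤ]) :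
      Set ℍ[ℤ])) (t := gaussianSphere r) (fun q => (⟨q.imI, q.imJ⟩ : GaussianInt))
      (by
        intro q hq
        rw [Finset.mem_coe, Finset.mem_filter] at hq
        have h1 := hmem q hq.1
        rw [hq.2] at h1
        simp only [gaussianSphere, Set.mem_ofPred_eq, Zsqrtd.norm_def]
        linarith)
      (by
        intro q hq q' hq' hqq
        rw [Finset.mem_coe, Finset.mem_filter] at hq hq'
        simp only [Zsqrtd.mk.injEq] at hqq
        ext
        · rw [(hT q hq.1).1, (hT q' hq'.1).1]
        · exact hqq.1
        · exact hqq.2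
        · rw [hq.2, hq'.2])
      (gaussianSphere_finite r)
    rw [Set.ncard_coe_finset] at this
    exact_mod_cast this
  have hmaps : ∀ q ∈ T, q.imK ∈ Finset.Icc (-(Nat.sqrt t : ℤ)) (Nat.sqrt t) := by
    intro q hq
    have h1 := hmem q hq
    have h2 : q.imK.natAbs ^ 2 ≤ t := by
      zify; rw [sq_abs]; nlinarith [sq_nonneg q.imI, sq_nonneg q.imJ]
    have h3 := Nat.le_sqrt'.2 h2
    rw [Finset.mem_Icc]; omega
  rw [Finset.card_eq_sum_card_fiberwise hmaps]
  push_cast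
  refine (Finset.sum_le_sum fun z _ => hfib z).trans ?_
  rw [Finset.sum_const, nsmul_eq_mul, Int.card_Icc]
  have h4 : (((Nat.sqrt t : ℤ) + 1 - -(Nat.sqrt t : ℤ)).toNat : ℝ) ≤ 3 * √t := by
    have h5 : ((Nat.sqrt t : ℤ) + 1 - -(Nat.sqrt t : ℤ)).toNat = 2 * Nat.sqrt t + 1 := by omega
    rw [h5]; push_cast
    have := Real.nat_sqrt_le_real_sqrt (a := t)
    linarith
  calc _ ≤ 3 * √t * (D * (t : ℝ) ^ ε) := by gcongr
    _ = _ := by ring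

lemma sum_inv_le (A : ℕ) (hA : 1 ≤ A) :
    ∑ a ∈ Finset.Ioo (-(A : ℤ)) A, 1 / ((A : ℝ) ^ 2 - (a : ℝ) ^ 2) ≤
      1 / A * (1 + Real.log (2 * A)) := by
  have hA0 : (0 : ℝ) < A := by exact_mod_cast hA
  have h1 : ∀ a ∈ Finset.Ioo (-(A : ℤ)) A, 1 / ((A : ℝ) ^ 2 - (a : ℝ) ^ 2) =
      1 / A * (1 / 2 * (1 / ((A : ℝ) - a)) + 1 / 2 * (1 / ((A : ℝ) + a))) := by
    intro a ha
    rw [Finset.mem_Ioo] at ha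
    have h2 : (0 : ℝ) < A - a := by
      have : (a : ℝ) < A := by exact_mod_cast ha.2
      linarith
    have h3 : (0 : ℝ) < A + a := by
      have : -(A : ℝ) < a := by exact_mod_cast ha.1
      linarith
    rw [show (A : ℝ) ^ 2 - a ^ 2 = (A - a) * (A + a) by ring]
    field_simp
    ring
  rw [Finset.sum_congr rfl h1, ← Finset.mul_sum, Finset.sum_add_distrib, ← Finset.mul_sum,
    ← Finset.mul_sum]
  have hplus : ∑ a ∈ Finset.Ioo (-(A : ℤ)) A, 1 / ((A : ℝ) + a) = (harmonic (2 * A - 1) : ℝ) := by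
    rw [harmonic]
    push_cast
    refine Finset.sum_nbij' (fun a => (a + A - 1).toNat) (fun k => (k : ℤ) + 1 - A) ?_ ?_ ?_ ?_ ?_
    · intro a ha; rw [Finset.mem_Ioo] at ha; rw [Finset.mem_range]; omega
    · intro k hk; rw [Finset.mem_range] at hk; rw [Finset.mem_Ioo]; omega
    · intro a ha; rw [Finset.mem_Ioo] at ha; omega
    · intro k _; omega
    · intro a ha
      rw [Finset.mem_Ioo] at ha
      have : (((a + A - 1).toNat : ℤ) : ℝ) = ((a + A - 1 : ℤ) : ℝ) := by
        rw [Int.toNat_of_nonneg (by omega)]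
      push_cast at this
      rw [this, one_div]
      congr 1; ring
  have hminus : ∑ a ∈ Finset.Ioo (-(A : ℤ)) A, 1 / ((A : ℝ) - a) =
      ∑ a ∈ Finset.Ioo (-(A : ℤ)) A, 1 / ((A : ℝ) + a) := by
    refine Finset.sum_nbij' (fun a => -a) (fun a => -a) ?_ ?_ ?_ ?_ ?_
    · intro a ha; rw [Finset.mem_Ioo] at *; omega
    · intro a ha; rw [Finset.mem_Ioo] at *; omega
    · intro a _; simp
    · intro a _; simp
    · intro a _; push_cast; congr 1
  rw [hminus, hplus]
  have h5 := harmonic_le_one_add_log (2 * A - 1)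
  have h6 : Real.log ((2 * A - 1 : ℕ) : ℝ) ≤ Real.log (2 * A) := by
    refine Real.log_le_log (by exact_mod_cast (by omega : 0 < 2 * A - 1)) ?_
    exact_mod_cast (by omega : 2 * A - 1 ≤ 2 * A)
  have h7 : 0 < 1 / (A : ℝ) := by positivity
  refine mul_le_mul_of_nonneg_left ?_ h7.le
  linarith

/-- The fourth moment of the `l`-th Chebyshev polynomial over integral quaternions of
norm `25 ^ n`. -/
lemma exists_sum_cheb_pow_four_le :
    ∃ C : ℝ, 0 < C ∧ ∀ (n l : ℕ) (T : Finset ℍ[ℤ]), (∀ q ∈ T, Quaternion.normSq q = 25 ^ n) →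
      ∑ q ∈ T, cheb ((q.re : ℝ) / 5 ^ n) l ^ 4 ≤
        2 * ((l : ℝ) + 1) ^ 4 + C * ((l : ℝ) + 1) * 25 ^ n * (11 / 10) ^ n := by
  obtain ⟨D, hD, hfib⟩ := card_fiber_le (ε := 1 / 100) (by norm_num)
  refine ⟨D * 300, by positivity, fun n l T hT => ?_⟩
  set A : ℕ := 5 ^ n with hA
  have hA1 : 1 ≤ A := Nat.one_le_pow _ _ (by norm_num)
  have hA1' : (1 : ℝ) ≤ A := by exact_mod_cast hA1
  have hAr : (5 : ℝ) ^ n = A := by simp [hA]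
  have hAz : (25 : ℤ) ^ n = (A : ℤ) ^ 2 := by
    rw [hA]; push_cast; rw [← pow_mul, mul_comm, pow_mul]; norm_num
  have hA25 : (25 : ℝ) ^ n = (A : ℝ) ^ 2 := by exact_mod_cast hAz
  rw [hAr]
  have hnorm : ∀ q ∈ T, q.re ^ 2 + q.imI ^ 2 + q.imJ ^ 2 + q.imK ^ 2 = (A : ℤ) ^ 2 := by
    intro q hq
    have := hT q hq
    rwa [Quaternion.normSq_def', hAz] at this
  have hmaps : ∀ q ∈ T, q.re ∈ Finset.Icc (-(A : ℤ)) A := by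
    intro q hq
    have h1 := hnorm q hq
    rw [Finset.mem_Icc]
    exact abs_le.1 (abs_le_of_sq_le_sq
      (by nlinarith [sq_nonneg q.imI, sq_nonneg q.imJ, sq_nonneg q.imK]) (by positivity))
  rw [← Finset.sum_fiberwise_of_maps_to hmaps]
  have hsum : ∀ a : ℤ, ∑ q ∈ T with q.re = a, cheb ((q.re : ℝ) / A) l ^ 4 =
      ((T.filter fun q => q.re = a).card : ℝ) * cheb ((a : ℝ) / A) l ^ 4 := by
    intro a
    rw [← nsmul_eq_mul, ← Finset.sum_const]
    refine Finset.sum_congr rfl fun q hq => ?_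
    rw [(Finset.mem_filter.1 hq).2]
  simp_rw [hsum]
  have hend : ∀ a : ℤ, a ^ 2 = (A : ℤ) ^ 2 →
      ((T.filter fun q => q.re = a).card : ℝ) * cheb ((a : ℝ) / A) l ^ 4 ≤ ((l : ℝ) + 1) ^ 4 := by
    intro a ha
    have hc : (T.filter fun q => q.re = a).card ≤ 1 := by
      refine Finset.card_le_one.2 fun q hq q' hq' => ?_
      have key : ∀ p ∈ T.filter fun q => q.re = a, p = (a : ℍ[ℤ]) := by
        intro p hp
        rw [Finset.mem_filter] at hp
        have h1 := hnorm p hp.1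
        rw [hp.2] at h1
        have hI : p.imI = 0 := by
          rw [← sq_eq_zero_iff]; nlinarith [sq_nonneg p.imI, sq_nonneg p.imJ, sq_nonneg p.imK]
        have hJ : p.imJ = 0 := by
          rw [← sq_eq_zero_iff]; nlinarith [sq_nonneg p.imI, sq_nonneg p.imJ, sq_nonneg p.imK]
        have hK : p.imK = 0 := by
          rw [← sq_eq_zero_iff]; nlinarith [sq_nonneg p.imI, sq_nonneg p.imJ, sq_nonneg p.imK]
        ext <;> simp [hp.2, hI, hJ, hK]
      rw [key q hq, key q' hq']
    have hx : ((a : ℝ) / A) ^ 2 ≤ 1 := by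
      rw [div_pow, show (a : ℝ) ^ 2 = (A : ℝ) ^ 2 by exact_mod_cast ha, div_self (by positivity)]
    have h2 : ((T.filter fun q => q.re = a).card : ℝ) ≤ 1 := by exact_mod_cast hc
    have h3 := cheb_pow_four_le hx l
    have h4 : 0 ≤ cheb ((a : ℝ) / A) l ^ 4 := by positivity
    nlinarith
  have hmid : ∀ a ∈ Finset.Ioo (-(A : ℤ)) A,
      ((T.filter fun q => q.re = a).card : ℝ) * cheb ((a : ℝ) / A) l ^ 4 ≤
        D * ((l : ℝ) + 1) * A ^ 3 * (A : ℝ) ^ (1 / 50 : ℝ) * (1 / ((A : ℝ) ^ 2 - (a : ℝ) ^ 2)) := by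
    intro a ha
    rw [Finset.mem_Ioo] at ha
    have hlt : a ^ 2 < (A : ℤ) ^ 2 := by nlinarith
    obtain ⟨t, ht⟩ := Int.eq_ofNat_of_zero_le (sub_nonneg.2 hlt.le)
    have ht1 : 1 ≤ t := by omega
    have ht1' : (1 : ℝ) ≤ t := by exact_mod_cast ht1
    have htr : (A : ℝ) ^ 2 - (a : ℝ) ^ 2 = t := by exact_mod_cast ht
    have hcard := hfib t a (T.filter fun q => q.re = a) ht1 (fun q hq => by
      rw [Finset.mem_filter] at hq
      exact ⟨hq.2, by rw [hT q hq.1, hAz]; linarith⟩)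
    have hx : ((a : ℝ) / A) ^ 2 ≤ 1 := by
      rw [div_pow, div_le_one (by positivity)]; nlinarith
    have hch := cheb_pow_four_mul_le hx l
    have hsq : √(1 - ((a : ℝ) / A) ^ 2) = √t / A := by
      rw [show 1 - ((a : ℝ) / A) ^ 2 = t / (A : ℝ) ^ 2 by
        rw [← htr]; field_simp, Real.sqrt_div (by positivity), Real.sqrt_sq (by positivity)]
    rw [hsq] at hch
    have hst : √t * √t = (t : ℝ) := Real.mul_self_sqrt (by positivity)
    have hst0 : 0 < √(t : ℝ) := Real.sqrt_pos.2 (by positivity)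
    have hch' : √(t : ℝ) * cheb ((a : ℝ) / A) l ^ 4 ≤ ((l : ℝ) + 1) * A ^ 3 * (1 / t) := by
      have : √(t : ℝ) * cheb ((a : ℝ) / A) l ^ 4 =
          cheb ((a : ℝ) / A) l ^ 4 * (√t / A) ^ 3 * (A ^ 3 * (1 / t)) := by
        rw [div_pow, show √(t : ℝ) ^ 3 = √t * t by rw [pow_succ, pow_two, hst, mul_comm]]
        field_simp
      rw [this, mul_assoc ((l : ℝ) + 1)]
      gcongr
    have htA : (t : ℝ) ^ (1 / 100 : ℝ) ≤ (A : ℝ) ^ (1 / 50 : ℝ) := by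
      have : (t : ℝ) ≤ (A : ℝ) ^ (2 : ℝ) := by
        rw [Real.rpow_two, ← htr]; nlinarith [sq_nonneg (a : ℝ)]
      calc (t : ℝ) ^ (1 / 100 : ℝ) ≤ ((A : ℝ) ^ (2 : ℝ)) ^ (1 / 100 : ℝ) := by gcongr
        _ = _ := by rw [← Real.rpow_mul (by positivity)]; norm_num
    rw [htr]
    calc _ ≤ (D * √t * (t : ℝ) ^ (1 / 100 : ℝ)) * cheb ((a : ℝ) / A) l ^ 4 := by gcongr
      _ = D * (t : ℝ) ^ (1 / 100 : ℝ) * (√(t : ℝ) * cheb ((a : ℝ) / A) l ^ 4) := by ring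
      _ ≤ D * (A : ℝ) ^ (1 / 50 : ℝ) * (((l : ℝ) + 1) * A ^ 3 * (1 / t)) := by gcongr
      _ = _ := by ring
  have hsplit : Finset.Icc (-(A : ℤ)) A ⊆
      insert (-(A : ℤ)) (insert (A : ℤ) (Finset.Ioo (-(A : ℤ)) A)) := by
    intro a ha
    rw [Finset.mem_Icc] at ha
    simp only [Finset.mem_insert, Finset.mem_Ioo]
    omega
  refine (Finset.sum_le_sum_of_subset_of_nonneg hsplit fun a _ _ => by positivity).trans ?_
  rw [Finset.sum_insert (by simp; omega), Finset.sum_insert (by simp)]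
  have h1 := hend (-A) (by ring)
  have h2 := hend A rfl
  have h3 := Finset.sum_le_sum hmid
  rw [← Finset.mul_sum] at h3
  have h4 := sum_inv_le A hA1
  have h5 : (A : ℝ) ^ (1 / 50 : ℝ) * (1 + Real.log (2 * A)) ≤ 300 * (11 / 10) ^ n := by
    have h6 : Real.log A ≤ (A : ℝ) ^ (1 / 100 : ℝ) / (1 / 100) :=
      Real.log_le_rpow_div (by positivity) (by norm_num)
    have h7 : Real.log 2 < 1 := by linarith [Real.log_two_lt_d9]
    have h8 : (1 : ℝ) ≤ (A : ℝ) ^ (1 / 100 : ℝ) := Real.one_le_rpow hA1' (by norm_num)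
    rw [Real.log_mul (by norm_num) (by positivity)]
    have h9 : (A : ℝ) ^ (1 / 50 : ℝ) = (A : ℝ) ^ (1 / 100 : ℝ) * (A : ℝ) ^ (1 / 100 : ℝ) := by
      rw [← Real.rpow_add (by positivity)]; norm_num
    have h10 : (A : ℝ) ^ (1 / 100 : ℝ) * (A : ℝ) ^ (1 / 100 : ℝ) * (A : ℝ) ^ (1 / 100 : ℝ) ≤
        (11 / 10) ^ n := by
      rw [← Real.rpow_add (by positivity), ← Real.rpow_add (by positivity), ← hAr,
        ← Real.rpow_natCast, ← Real.rpow_mul (by norm_num), mul_comm, Real.rpow_mul (by norm_num),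
        Real.rpow_natCast]
      refine pow_le_pow_left₀ (by positivity) ?_ n
      rw [show (1 / 100 + 1 / 100 + 1 / 100 : ℝ) = 3 * (1 / 100) by norm_num,
        Real.rpow_mul (by norm_num), one_div]
      rw [Real.rpow_inv_le_iff_of_pos (by positivity) (by norm_num) (by norm_num)]
      norm_num
    rw [h9]
    set y := (A : ℝ) ^ (1 / 100 : ℝ)
    have h11 : 1 + (Real.log 2 + Real.log A) ≤ 300 * y := by linarith
    calc y * y * (1 + (Real.log 2 + Real.log A)) ≤ y * y * (300 * y) := by gcongr
      _ = 300 * (y * y * y) := by ring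
      _ ≤ _ := by gcongr
  have h12 : D * ((l : ℝ) + 1) * A ^ 3 * (A : ℝ) ^ (1 / 50 : ℝ) *
      ∑ a ∈ Finset.Ioo (-(A : ℤ)) A, 1 / ((A : ℝ) ^ 2 - (a : ℝ) ^ 2) ≤
      D * 300 * ((l : ℝ) + 1) * 25 ^ n * (11 / 10) ^ n := by
    calc _ ≤ D * ((l : ℝ) + 1) * A ^ 3 * (A : ℝ) ^ (1 / 50 : ℝ) *
          (1 / A * (1 + Real.log (2 * A))) := by gcongr
      _ = D * ((l : ℝ) + 1) * A ^ 2 * ((A : ℝ) ^ (1 / 50 : ℝ) * (1 + Real.log (2 * A))) := by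
          field_simp
      _ ≤ D * ((l : ℝ) + 1) * A ^ 2 * (300 * (11 / 10) ^ n) := by gcongr
      _ = _ := by rw [hA25]; ring
  linarith

end BoxCounting

namespace BoxCounting

open scoped Quaternion

lemma exists_eq_smul_primitive (M : ℕ) (p : ℍ[ℤ]) (hp : Quaternion.normSq p = 25 ^ M) :
    ∃ i ≤ M, ∃ q : ℍ[ℤ], IsPrimitive q ∧ p = (5 ^ (M - i) : ℤ) • q ∧
      Quaternion.normSq q = 25 ^ i := by
  induction M generalizing p with
  | zero =>
    refine ⟨0, le_rfl, p, ?_, by simp, hp⟩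
    rintro r rfl
    rw [normSq_int_smul] at hp
    omega
  | succ M ih =>
    by_cases h : IsPrimitive p
    · exact ⟨M + 1, le_rfl, p, h, by simp, hp⟩
    · simp only [IsPrimitive, not_forall, not_not] at h
      obtain ⟨r, rfl⟩ := h
      rw [normSq_int_smul, pow_succ (25 : ℤ)] at hp
      obtain ⟨i, hi, q, h1, h2, h3⟩ := ih r (by omega)
      refine ⟨i, by omega, q, h1, ?_, h3⟩
      rw [h2, smul_smul, show M + 1 - i = M - i + 1 by omega, pow_succ' (5 : ℤ)]

lemma exists_sum_walk_cheb_pow_four_le :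
    ∃ C : ℝ, 0 < C ∧ ∀ M l : ℕ,
      ∑ w : Fin (2 * M) → Fin 6, cheb (((walk w).re : ℝ) / 5 ^ M) l ^ 4 ≤
        2 * ((l : ℝ) + 1) ^ 4 * ((M + 1) * 20 ^ M) +
          C * ((l : ℝ) + 1) * (11 / 10) ^ M * 36 ^ M := by
  classical
  obtain ⟨C, hC, hB⟩ := exists_sum_cheb_pow_four_le
  refine ⟨C, hC, fun M l => ?_⟩
  have hex : ∀ w : Fin (2 * M) → Fin 6, ∃ i ≤ M, ∃ q : ℍ[ℤ], IsPrimitive q ∧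
      walk w = (5 ^ (M - i) : ℤ) • q ∧ Quaternion.normSq q = 25 ^ i := fun w =>
    exists_eq_smul_primitive M _ (by rw [normSq_walk, pow_mul]; norm_num)
  choose I hI Q hQ hwQ hnQ using hex
  have hmaps : ∀ w ∈ (Finset.univ : Finset (Fin (2 * M) → Fin 6)),
      I w ∈ Finset.range (M + 1) := fun w _ => by
    rw [Finset.mem_range]; have := hI w; omega
  rw [← Finset.sum_fiberwise_of_maps_to hmaps]
  have hlevel : ∀ i ∈ Finset.range (M + 1),
      ∑ w with I w = i, cheb (((walk w).re : ℝ) / 5 ^ M) l ^ 4 ≤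
        walkBound (2 * M) (2 * i) *
          (2 * ((l : ℝ) + 1) ^ 4 + C * ((l : ℝ) + 1) * 25 ^ i * (11 / 10) ^ i) := by
    intro i hi
    rw [Finset.mem_range] at hi
    rw [← Finset.sum_fiberwise_of_maps_to (fun w hw => Finset.mem_image_of_mem Q hw)]
    refine le_trans ?_ (mul_le_mul_of_nonneg_left (hB i l
      ((Finset.univ.filter fun w => I w = i).image Q) ?_) (by positivity))
    · rw [Finset.mul_sum]
      refine Finset.sum_le_sum fun q hq => ?_
      have hval : ∀ w ∈ (Finset.univ.filter fun w => I w = i).filter (fun w => Q w = q),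
          cheb (((walk w).re : ℝ) / 5 ^ M) l ^ 4 = cheb ((q.re : ℝ) / 5 ^ i) l ^ 4 := by
        intro w hw
        simp only [Finset.mem_filter, Finset.mem_univ, true_and] at hw
        have h1 := congrArg QuaternionAlgebra.re (hwQ w)
        rw [hw.1, hw.2] at h1
        simp only [Quaternion.re_smul, smul_eq_mul] at h1
        rw [h1]
        congr 2
        push_cast
        rw [show (5 : ℝ) ^ M = 5 ^ (M - i) * 5 ^ i by rw [← pow_add]; congr 1; omega]
        field_simp
      rw [Finset.sum_congr rfl hval, Finset.sum_const, nsmul_eq_mul]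
      refine mul_le_mul_of_nonneg_right ?_ (by positivity)
      rw [Finset.mem_image] at hq
      obtain ⟨w₀, hw₀, rfl⟩ := hq
      simp only [Finset.mem_filter, Finset.mem_univ, true_and] at hw₀
      have hb := card_walk_le (2 * M) (2 * i) (M - i) (Q w₀) (hQ w₀) (by
        rw [hnQ, hw₀, pow_mul]; norm_num)
      refine Nat.cast_le.2 ((Finset.card_le_card fun w hw => ?_).trans hb)
      simp only [Finset.mem_filter, Finset.mem_univ, true_and] at hw ⊢
      rw [← hw.2, ← hw.1]; exact hwQ w
    · intro q hq
      rw [Finset.mem_image] at hq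
      obtain ⟨w₀, hw₀, rfl⟩ := hq
      simp only [Finset.mem_filter, Finset.mem_univ, true_and] at hw₀
      rw [hnQ, hw₀]
  refine (Finset.sum_le_sum hlevel).trans ?_
  simp_rw [mul_add]
  rw [Finset.sum_add_distrib]
  refine add_le_add ?_ ?_
  · rw [← Finset.sum_mul, mul_comm (2 * ((l : ℝ) + 1) ^ 4)]
    refine mul_le_mul_of_nonneg_right ?_ (by positivity)
    refine (Finset.sum_le_sum fun i _ => walkBound_two_mul_le M (2 * i)).trans ?_
    rw [Finset.sum_const, Finset.card_range, nsmul_eq_mul]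
    push_cast; rfl
  · have h1 : ∑ i ∈ Finset.range (M + 1), walkBound (2 * M) (2 * i) * 5 ^ (2 * i) ≤
        6 ^ (2 * M) := by
      refine le_trans ?_ (sum_walkBound_mul_five_pow_le (2 * M) (2 * M + 1))
      rw [← Finset.sum_image (f := fun m => walkBound (2 * M) m * 5 ^ m)
        (g := fun i => 2 * i) (fun a _ b _ h => by simpa using h)]
      refine Finset.sum_le_sum_of_subset fun m hm => ?_
      simp only [Finset.mem_image, Finset.mem_range] at hm ⊢
      omega
    have h2 : ∑ i ∈ Finset.range (M + 1), (walkBound (2 * M) (2 * i) : ℝ) * 25 ^ i ≤ 36 ^ M := by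
      have h3 : ∑ i ∈ Finset.range (M + 1), walkBound (2 * M) (2 * i) * 25 ^ i ≤ 36 ^ M := by
        simpa only [pow_mul, show 5 ^ 2 = 25 from rfl, show 6 ^ 2 = 36 from rfl] using h1
      exact_mod_cast h3
    calc _ ≤ ∑ i ∈ Finset.range (M + 1), C * ((l : ℝ) + 1) * (11 / 10) ^ M *
          ((walkBound (2 * M) (2 * i) : ℝ) * 25 ^ i) := by
          refine Finset.sum_le_sum fun i hi => ?_
          rw [Finset.mem_range] at hi
          have : ((11 : ℝ) / 10) ^ i ≤ (11 / 10) ^ M :=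
            pow_le_pow_right₀ (by norm_num) (by omega)
          calc _ = C * ((l : ℝ) + 1) * (11 / 10) ^ i *
              ((walkBound (2 * M) (2 * i) : ℝ) * 25 ^ i) := by ring
            _ ≤ _ := by gcongr
      _ ≤ _ := by
          rw [← Finset.mul_sum]
          exact (mul_le_mul_of_nonneg_left h2 (by positivity)).trans (le_of_eq (by ring))

end BoxCounting

namespace BoxCounting

open Polynomial

/-! ### Symmetric powers of two by two matrices -/

/-- The image of the monomial `X ^ i` (of formal degree `j`) under a linear substitution. -/
noncomputable def symRow (j : ℕ) (M : Matrix (Fin 2) (Fin 2) ℂ) (i : ℕ) : ℂ[X] :=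
  (C (M 0 0) * X + C (M 0 1)) ^ i * (C (M 1 0) * X + C (M 1 1)) ^ (j - i)

/-- The `j`-th symmetric power of a two by two matrix in the monomial basis. -/
noncomputable def symPow (j : ℕ) (M : Matrix (Fin 2) (Fin 2) ℂ) :
    Matrix (Fin (j + 1)) (Fin (j + 1)) ℂ :=
  Matrix.of fun i l => (symRow j M i).coeff l

lemma homogenize_linear_pow (a b : ℂ) (i : ℕ) :
    ((C a * X + C b) ^ i).homogenize i =
      (MvPolynomial.C a * MvPolynomial.X 0 + MvPolynomial.C b * MvPolynomial.X 1) ^ i := by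
  induction i with
  | zero => simp
  | succ i ih =>
    rw [pow_succ, homogenize_mul _ _ ((natDegree_pow_le_of_le i natDegree_linear_le).trans
      (by simp)) natDegree_linear_le, ih, pow_succ]
    simp

lemma aeval_homogenize {S : Type*} [CommRing S] [Algebra ℂ S] (p : ℂ[X]) (j : ℕ) (x y : S) :
    MvPolynomial.aeval ![x, y] (p.homogenize j) =
      ∑ l : Fin (j + 1), algebraMap ℂ S (p.coeff l) * (x ^ (l : ℕ) * y ^ (j - l)) := by
  rw [homogenize, map_sum, Finset.Nat.sum_antidiagonal_eq_sum_range_succ_mk,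
    ← Fin.sum_univ_eq_sum_range (n := j + 1) (f := fun l => MvPolynomial.aeval ![x, y]
      (MvPolynomial.monomial (fun₀ | 0 => l | 1 => j - l) (p.coeff l)))]
  refine Finset.sum_congr rfl fun l _ => ?_
  rw [MvPolynomial.aeval_monomial]
  congr 1
  rw [Finsupp.prod_fintype _ _ (by simp)]
  simp

lemma sum_symPow_mul {S : Type*} [CommRing S] [Algebra ℂ S] (j : ℕ)
    (M : Matrix (Fin 2) (Fin 2) ℂ) (i : Fin (j + 1)) (x y : S) :
    ∑ l, algebraMap ℂ S (symPow j M i l) * (x ^ (l : ℕ) * y ^ (j - l)) =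
      (algebraMap ℂ S (M 0 0) * x + algebraMap ℂ S (M 0 1) * y) ^ (i : ℕ) *
      (algebraMap ℂ S (M 1 0) * x + algebraMap ℂ S (M 1 1) * y) ^ (j - i) := by
  have h := aeval_homogenize (symRow j M i) j x y
  simp only [symPow, Matrix.of_apply]
  rw [← h]
  have hij : (i : ℕ) + (j - i) = j := by omega
  have h2 : (symRow j M i).homogenize j = ((C (M 0 0) * X + C (M 0 1)) ^ (i : ℕ)).homogenize i *
      ((C (M 1 0) * X + C (M 1 1)) ^ (j - i)).homogenize (j - i) := by
    rw [← homogenize_mul _ _ ((natDegree_pow_le_of_le _ natDegree_linear_le).trans (by simp))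
      ((natDegree_pow_le_of_le _ natDegree_linear_le).trans (by simp)), hij]
    rfl
  rw [h2, homogenize_linear_pow, homogenize_linear_pow]
  simp

lemma symPow_mul (j : ℕ) (M N : Matrix (Fin 2) (Fin 2) ℂ) :
    symPow j (M * N) = symPow j M * symPow j N := by
  ext i l
  have h := sum_symPow_mul (S := ℂ[X]) j M i (C (N 0 0) * X + C (N 0 1))
    (C (N 1 0) * X + C (N 1 1))
  have h2 : symRow j (M * N) i =
      ∑ k : Fin (j + 1), C (symPow j M i k) * symRow j N k := by
    refine Eq.trans ?_ h.symm
    simp only [symRow, Matrix.mul_apply, Fin.sum_univ_two, algebraMap_eq, map_add, map_mul]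
    congr 2 <;> ring
  rw [Matrix.mul_apply]
  simp only [symPow, Matrix.of_apply] at h2 ⊢
  rw [h2, finsetSum_coeff]
  simp

lemma symPow_one (j : ℕ) : symPow j 1 = 1 := by
  ext i l
  simp [symPow, symRow, coeff_X_pow, Matrix.one_apply, Fin.ext_iff, eq_comm]

lemma coeff_linear_pow (u v : ℂ) (j l : ℕ) (hl : l ≤ j) :
    ((C u * X + C v) ^ j).coeff l = u ^ l * v ^ (j - l) * j.choose l := by
  rw [add_pow, finsetSum_coeff, Finset.sum_eq_single l]
  · rw [mul_pow, ← C_pow, ← C_pow, mul_assoc, mul_assoc, coeff_C_mul, ← C_eq_natCast, ← C_mul,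
      X_pow_mul_C, coeff_C_mul, coeff_X_pow_self]
    ring
  · intro m _ hm
    rw [mul_pow, ← C_pow, ← C_pow, mul_assoc, mul_assoc, coeff_C_mul, ← C_eq_natCast, ← C_mul,
      X_pow_mul_C, coeff_C_mul, coeff_X_pow, if_neg (Ne.symm hm)]
    ring
  · intro h
    exact absurd (Finset.mem_range.2 (by omega)) h

lemma choose_mul_symPow (j : ℕ) (M : Matrix (Fin 2) (Fin 2) ℂ) (i l : Fin (j + 1)) :
    (j.choose i : ℂ) * symPow j M i l = j.choose l * symPow j M.transpose l i := by
  have hi : (i : ℕ) ≤ j := by omega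
  have hl : (l : ℕ) ≤ j := by omega
  have key : ∑ k ∈ Finset.range (j + 1), C ((j.choose k : ℂ) * (symRow j M k).coeff l) * X ^ k =
      C (j.choose l : ℂ) * symRow j M.transpose l := by
    refine Polynomial.funext fun y => ?_
    have h1 : (∑ k ∈ Finset.range (j + 1), C ((j.choose k : ℂ) * y ^ k) * symRow j M k) =
        (C (y * M 0 0 + M 1 0) * X + C (y * M 0 1 + M 1 1)) ^ j := by
      have h2 : C (y * M 0 0 + M 1 0) * X + C (y * M 0 1 + M 1 1) =
          C y * (C (M 0 0) * X + C (M 0 1)) + (C (M 1 0) * X + C (M 1 1)) := by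
        simp only [map_add, map_mul]; ring
      rw [h2, add_pow]
      refine Finset.sum_congr rfl fun k _ => ?_
      rw [symRow, mul_pow, C_mul, C_pow, C_eq_natCast]; ring
    have h3 := congrArg (fun p => p.coeff l) h1
    simp only [finsetSum_coeff, coeff_C_mul] at h3
    rw [coeff_linear_pow _ _ _ _ hl] at h3
    rw [eval_finsetSum]
    simp only [eval_mul, eval_C, eval_pow, eval_X, symRow, Matrix.transpose_apply, eval_add]
    rw [mul_comm (M 0 0) y, mul_comm (M 0 1) y, mul_comm (j.choose l : ℂ), ← h3]
    refine Finset.sum_congr rfl fun k _ => ?_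
    rw [symRow]; ring
  have h4 := congrArg (fun p => p.coeff i) key
  simp only [finsetSum_coeff, coeff_C_mul, coeff_X_pow] at h4
  simp only [mul_ite, mul_one, mul_zero, Finset.sum_ite_eq, Finset.mem_range] at h4
  rw [if_pos (by omega)] at h4
  simpa [symPow] using h4

lemma symPow_map_conj (j : ℕ) (M : Matrix (Fin 2) (Fin 2) ℂ) (i l : Fin (j + 1)) :
    symPow j (M.map (starRingEnd ℂ)) i l = starRingEnd ℂ (symPow j M i l) := by
  simp only [symPow, Matrix.of_apply]
  rw [← coeff_map]
  congr 1
  simp [symRow]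

/-- The `j`-th symmetric power in an orthonormal basis. -/
noncomputable def rep (j : ℕ) (M : Matrix (Fin 2) (Fin 2) ℂ) :
    Matrix (Fin (j + 1)) (Fin (j + 1)) ℂ :=
  Matrix.diagonal (fun i : Fin (j + 1) => ((√(j.choose i) : ℝ) : ℂ)) * symPow j M *
    Matrix.diagonal (fun i : Fin (j + 1) => ((√(j.choose i) : ℝ) : ℂ)⁻¹)

lemma sqrt_choose_ne_zero (j : ℕ) (i : Fin (j + 1)) : ((√(j.choose i) : ℝ) : ℂ) ≠ 0 := by
  have : 0 < j.choose i := Nat.choose_pos (by omega)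
  exact_mod_cast (Real.sqrt_pos.2 (by exact_mod_cast this)).ne'

lemma diagonal_mul_diagonal_inv (j : ℕ) :
    Matrix.diagonal (fun i : Fin (j + 1) => ((√(j.choose i) : ℝ) : ℂ)⁻¹) *
      Matrix.diagonal (fun i : Fin (j + 1) => ((√(j.choose i) : ℝ) : ℂ)) = 1 := by
  rw [Matrix.diagonal_mul_diagonal, ← Matrix.diagonal_one]
  congr 1
  ext i
  exact inv_mul_cancel₀ (sqrt_choose_ne_zero j i)

lemma rep_mul (j : ℕ) (M N : Matrix (Fin 2) (Fin 2) ℂ) : rep j (M * N) = rep j M * rep j N := by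
  simp only [rep, symPow_mul]
  conv_lhs => rw [← mul_one (symPow j M), ← diagonal_mul_diagonal_inv j]
  simp only [mul_assoc]

lemma rep_one (j : ℕ) : rep j 1 = 1 := by
  rw [rep, symPow_one, mul_one, Matrix.diagonal_mul_diagonal, ← Matrix.diagonal_one]
  congr 1
  ext i
  exact mul_inv_cancel₀ (sqrt_choose_ne_zero j i)

lemma rep_apply (j : ℕ) (M : Matrix (Fin 2) (Fin 2) ℂ) (i l : Fin (j + 1)) :
    rep j M i l = (√(j.choose i) : ℝ) * symPow j M i l * ((√(j.choose l) : ℝ) : ℂ)⁻¹ := by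
  simp [rep, Matrix.mul_diagonal, Matrix.diagonal_mul]

lemma rep_conjTranspose (j : ℕ) (M : Matrix (Fin 2) (Fin 2) ℂ) :
    rep j M.conjTranspose = (rep j M).conjTranspose := by
  ext i l
  rw [Matrix.conjTranspose_apply, rep_apply, rep_apply]
  have h := choose_mul_symPow j (M.map (starRingEnd ℂ)) l i
  rw [symPow_map_conj] at h
  have hM : (M.map (starRingEnd ℂ)).transpose = M.conjTranspose := rfl
  rw [hM] at h
  have hi := sqrt_choose_ne_zero j i
  have hl := sqrt_choose_ne_zero j l
  have hi2 : (j.choose i : ℂ) = (√(j.choose i) : ℝ) * (√(j.choose i) : ℝ) := by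
    rw [← Complex.ofReal_mul, Real.mul_self_sqrt (by positivity)]; simp
  have hl2 : (j.choose l : ℂ) = (√(j.choose l) : ℝ) * (√(j.choose l) : ℝ) := by
    rw [← Complex.ofReal_mul, Real.mul_self_sqrt (by positivity)]; simp
  rw [hi2, hl2] at h
  simp only [star_mul', star_inv₀, RCLike.star_def, Complex.conj_ofReal]
  field_simp
  linear_combination -h

lemma trace_rep_eq_trace_symPow (j : ℕ) (M : Matrix (Fin 2) (Fin 2) ℂ) :
    (rep j M).trace = (symPow j M).trace := by
  rw [rep, Matrix.trace_mul_comm, ← mul_assoc, diagonal_mul_diagonal_inv, one_mul]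

lemma trace_symPow_of_lower (j : ℕ) (M : Matrix (Fin 2) (Fin 2) ℂ) (h : M 0 1 = 0) :
    (symPow j M).trace = ∑ i : Fin (j + 1), M 0 0 ^ (i : ℕ) * M 1 1 ^ (j - i) := by
  rw [Matrix.trace]
  refine Finset.sum_congr rfl fun i _ => ?_
  simp only [Matrix.diag_apply, symPow, Matrix.of_apply, symRow, h, map_zero, add_zero, mul_pow,
    ← C_pow]
  rw [mul_assoc, coeff_C_mul, mul_comm (X ^ (i : ℕ)), coeff_mul_X_pow']
  simp [coeff_zero_eq_eval_zero]

lemma trace_symPow_of_upper (j : ℕ) (M : Matrix (Fin 2) (Fin 2) ℂ) (h : M 1 0 = 0) :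
    (symPow j M).trace = ∑ i : Fin (j + 1), M 0 0 ^ (i : ℕ) * M 1 1 ^ (j - i) := by
  rw [Matrix.trace]
  refine Finset.sum_congr rfl fun i _ => ?_
  simp only [Matrix.diag_apply, symPow, Matrix.of_apply, symRow, h, map_zero, zero_mul, zero_add,
    ← C_pow]
  rw [coeff_mul_C, coeff_linear_pow _ _ _ _ le_rfl]
  simp

lemma sum_pow_mul_pow_eq_cheb {a d : ℂ} {x : ℝ} (h1 : a * d = 1) (h2 : a + d = 2 * x) (j : ℕ) :
    ∑ i : Fin (j + 1), a ^ (i : ℕ) * d ^ (j - i) = cheb x j := by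
  rw [Fin.sum_univ_eq_sum_range (fun i => a ^ i * d ^ (j - i)) (j + 1)]
  have hstep : ∀ j, ∑ i ∈ Finset.range (j + 2), a ^ i * d ^ (j + 1 - i) =
      a * (∑ i ∈ Finset.range (j + 1), a ^ i * d ^ (j - i)) + d ^ (j + 1) := by
    intro j
    rw [Finset.sum_range_succ', Finset.mul_sum]
    simp only [Nat.add_sub_add_right, pow_zero, one_mul, Nat.sub_zero, pow_succ']
    congr 1
    exact Finset.sum_congr rfl fun i _ => by ring
  induction j using Nat.twoStepInduction with
  | zero => simp [cheb]
  | one => simp [Finset.sum_range_succ, cheb, ← h2]; ring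
  | more j ih0 ih1 =>
    have e1 := hstep (j + 1)
    have e0 := hstep j
    rw [cheb]
    push_cast
    rw [← ih0, ← ih1, e1, ← h2]
    rw [e0]
    rw [pow_succ d (j + 1)]
    linear_combination (- ∑ i ∈ Finset.range (j + 1), a ^ i * d ^ (j - i)) * h1

lemma exists_triangular (M : Matrix (Fin 2) (Fin 2) ℂ) (hb : M 0 1 ≠ 0) :
    ∃ N N' : Matrix (Fin 2) (Fin 2) ℂ, N' * N = 1 ∧ (N * M * N') 1 0 = 0 := by
  obtain ⟨t, ht⟩ := exists_quadratic_eq_zero (a := -M 0 1) (b := M 0 0 - M 1 1) (c := M 1 0)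
    (neg_ne_zero.2 hb) (by
      obtain ⟨s, hs⟩ := IsAlgClosed.exists_pow_nat_eq
        (discrim (-M 0 1) (M 0 0 - M 1 1) (M 1 0)) (n := 2) (by norm_num)
      exact ⟨s, by rw [← hs, pow_two]⟩)
  refine ⟨!![1, 0; t, 1], !![1, 0; -t, 1], ?_, ?_⟩
  · ext i j; fin_cases i <;> fin_cases j <;> simp [Matrix.mul_apply, Fin.sum_univ_two]
  · simp [Matrix.mul_apply, Matrix.vecMul, dotProduct, Fin.sum_univ_two]
    linear_combination ht

lemma trace_rep {M : Matrix (Fin 2) (Fin 2) ℂ} {x : ℝ} (hdet : M.det = 1)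
    (htr : M.trace = 2 * x) (j : ℕ) : (rep j M).trace = cheb x j := by
  rw [trace_rep_eq_trace_symPow]
  by_cases hb : M 0 1 = 0
  · rw [trace_symPow_of_lower j M hb]
    refine sum_pow_mul_pow_eq_cheb ?_ ?_ j
    · rw [← hdet, Matrix.det_fin_two, hb]; ring
    · rw [← htr, Matrix.trace_fin_two]
  · obtain ⟨N, N', h1, h2⟩ := exists_triangular M hb
    have h3 : (symPow j (N * M * N')).trace = (symPow j M).trace := by
      rw [symPow_mul, Matrix.trace_mul_comm, symPow_mul, ← mul_assoc, ← symPow_mul, h1, symPow_one,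
        one_mul]
    rw [← h3, trace_symPow_of_upper j _ h2]
    refine sum_pow_mul_pow_eq_cheb ?_ ?_ j
    · have h4 : (N * M * N').det = 1 := by
        rw [Matrix.det_mul_comm, ← mul_assoc, h1, one_mul, hdet]
      rw [← h4, Matrix.det_fin_two, h2]; ring
    · have h4 : (N * M * N').trace = 2 * x := by
        rw [Matrix.trace_mul_comm, ← mul_assoc, h1, one_mul, htr]
      rw [← h4, Matrix.trace_fin_two]

end BoxCounting

namespace BoxCounting

open Polynomial
open scoped Quaternion

/-! ### The averaging operators in the irreducible representations -/

/-- The matrix of a quaternion. -/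
noncomputable def toMat (q : ℍ[ℝ]) : Matrix (Fin 2) (Fin 2) ℂ :=
  !![⟨q.re, q.imI⟩, ⟨q.imJ, q.imK⟩; ⟨-q.imJ, q.imK⟩, ⟨q.re, -q.imI⟩]

lemma toMat_mul (p q : ℍ[ℝ]) : toMat (p * q) = toMat p * toMat q := by
  ext i j
  fin_cases i <;> fin_cases j <;>
    simp [toMat, Matrix.mul_apply, Fin.sum_univ_two, Complex.ext_iff] <;> constructor <;> ring

lemma toMat_one : toMat 1 = 1 := by
  ext i j
  fin_cases i <;> fin_cases j <;> simp [toMat, Complex.ext_iff]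

lemma toMat_star (q : ℍ[ℝ]) : toMat (star q) = (toMat q).conjTranspose := by
  ext i j
  fin_cases i <;> fin_cases j <;> simp [toMat, Matrix.conjTranspose_apply, Complex.ext_iff]

lemma det_toMat (q : ℍ[ℝ]) : (toMat q).det = (Quaternion.normSq q : ℝ) := by
  rw [Matrix.det_fin_two, Quaternion.normSq_def']
  simp only [pow_two]
  apply Complex.ext
  · simp [toMat]
    ring
  · simp [toMat]
    ring

lemma trace_toMat (q : ℍ[ℝ]) : (toMat q).trace = 2 * (q.re : ℝ) := by
  rw [Matrix.trace_fin_two]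
  apply Complex.ext
  · simp [toMat]
    ring
  · simp [toMat]

/-- The representation of the quaternions on homogeneous polynomials of degree `j`. -/
noncomputable def qrep (j : ℕ) (q : ℍ[ℝ]) : Matrix (Fin (j + 1)) (Fin (j + 1)) ℂ :=
  rep j (toMat q)

lemma qrep_mul (j : ℕ) (p q : ℍ[ℝ]) : qrep j (p * q) = qrep j p * qrep j q := by
  rw [qrep, toMat_mul, rep_mul]; rfl

lemma qrep_one (j : ℕ) : qrep j 1 = 1 := by
  rw [qrep, toMat_one, rep_one]

lemma qrep_star (j : ℕ) (q : ℍ[ℝ]) : qrep j (star q) = (qrep j q).conjTranspose := by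
  rw [qrep, toMat_star, rep_conjTranspose]; rfl

lemma qrep_conjTranspose_mul_self (j : ℕ) {q : ℍ[ℝ]} (hq : Quaternion.normSq q = 1) :
    (qrep j q).conjTranspose * qrep j q = 1 := by
  rw [← qrep_star, ← qrep_mul, Quaternion.star_mul_self, hq, ← qrep_one]; rfl

lemma trace_qrep (j : ℕ) {q : ℍ[ℝ]} (hq : Quaternion.normSq q = 1) :
    (qrep j q).trace = cheb q.re j :=
  trace_rep (by rw [det_toMat, hq]; simp) (trace_toMat q) j

/-- The inclusion of integral quaternions into real quaternions. -/
def realQ (q : ℍ[ℤ]) : ℍ[ℝ] := ⟨q.re, q.imI, q.imJ, q.imK⟩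

@[simp] lemma realQ_re (q : ℍ[ℤ]) : (realQ q).re = q.re := rfl
@[simp] lemma realQ_imI (q : ℍ[ℤ]) : (realQ q).imI = q.imI := rfl
@[simp] lemma realQ_imJ (q : ℍ[ℤ]) : (realQ q).imJ = q.imJ := rfl
@[simp] lemma realQ_imK (q : ℍ[ℤ]) : (realQ q).imK = q.imK := rfl

lemma realQ_mul (p q : ℍ[ℤ]) : realQ (p * q) = realQ p * realQ q := by
  ext <;> simp

/-- The steps of the walk, normalized to be unit quaternions. -/
noncomputable def unitStep (s : Fin 6) : ℍ[ℝ] := (√5)⁻¹ • realQ (step s)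

lemma unitStep_re (s : Fin 6) : (unitStep s).re = (√5)⁻¹ := by
  have h : (step s).re = 1 := by fin_cases s <;> rfl
  simp [unitStep, h]

lemma unitStep_imI (s : Fin 6) : (unitStep s).imI = (√5)⁻¹ * ![2, -2, 0, 0, 0, 0] s := by
  have h : (step s).imI = ![2, -2, 0, 0, 0, 0] s := by fin_cases s <;> rfl
  rw [unitStep, Quaternion.imI_smul, realQ_imI, h]
  fin_cases s <;> simp

lemma unitStep_imJ (s : Fin 6) : (unitStep s).imJ = (√5)⁻¹ * ![0, 0, 2, -2, 0, 0] s := by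
  have h : (step s).imJ = ![0, 0, 2, -2, 0, 0] s := by fin_cases s <;> rfl
  rw [unitStep, Quaternion.imJ_smul, realQ_imJ, h]
  fin_cases s <;> simp

lemma unitStep_imK (s : Fin 6) : (unitStep s).imK = (√5)⁻¹ * ![0, 0, 0, 0, 2, -2] s := by
  have h : (step s).imK = ![0, 0, 0, 0, 2, -2] s := by fin_cases s <;> rfl
  rw [unitStep, Quaternion.imK_smul, realQ_imK, h]
  fin_cases s <;> simp

/-- The walk with normalized steps. -/
noncomputable def unitWalk {L : ℕ} (w : Fin L → Fin 6) : ℍ[ℝ] :=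
  (List.ofFn fun i => unitStep (w i)).prod

lemma unitWalk_zero (w : Fin 0 → Fin 6) : unitWalk w = 1 := by simp [unitWalk]

lemma unitWalk_cons {L : ℕ} (s : Fin 6) (w : Fin L → Fin 6) :
    unitWalk (Fin.cons s w : Fin (L + 1) → Fin 6) = unitStep s * unitWalk w := by
  simp [unitWalk, List.ofFn_succ]

lemma unitWalk_eq {L : ℕ} (w : Fin L → Fin 6) :
    unitWalk w = ((√5)⁻¹ ^ L) • realQ (walk w) := by
  induction L with
  | zero => rw [unitWalk_zero, walk_zero]; ext <;> simp
  | succ L ih =>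
    rw [← Fin.cons_self_tail w, unitWalk_cons, walk_cons, ih, realQ_mul, unitStep,
      smul_mul_smul_comm, pow_succ']

lemma normSq_unitStep (s : Fin 6) : Quaternion.normSq (unitStep s) = 1 := by
  have h := normSq_step s
  have h5 : √5 * √5 = (5 : ℝ) := Real.mul_self_sqrt (by norm_num)
  rw [Quaternion.normSq_def'] at h ⊢
  have h' : ((step s).re : ℝ) ^ 2 + ((step s).imI : ℝ) ^ 2 + ((step s).imJ : ℝ) ^ 2 +
    ((step s).imK : ℝ) ^ 2 = 5 := by exact_mod_cast h
  simp only [unitStep, Quaternion.re_smul, Quaternion.imI_smul, Quaternion.imJ_smul,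
    Quaternion.imK_smul, smul_eq_mul, realQ_re, realQ_imI, realQ_imJ, realQ_imK]
  have h6 : (√(5 : ℝ))⁻¹ ^ 2 = 5⁻¹ := by rw [inv_pow, pow_two, h5]
  simp only [mul_pow, h6]
  linarith

lemma normSq_unitWalk {L : ℕ} (w : Fin L → Fin 6) : Quaternion.normSq (unitWalk w) = 1 := by
  induction L with
  | zero => rw [unitWalk_zero, map_one]
  | succ L ih => rw [← Fin.cons_self_tail w, unitWalk_cons, map_mul, normSq_unitStep, ih, one_mul]

lemma unitWalk_re_two_mul {M : ℕ} (w : Fin (2 * M) → Fin 6) :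
    (unitWalk w).re = ((walk w).re : ℝ) / 5 ^ M := by
  rw [unitWalk_eq, pow_mul, inv_pow, Real.sq_sqrt (by norm_num)]
  simp
  ring

/-- The sum of the steps of the walk in the representation of degree `j`. -/
noncomputable def stepSum (j : ℕ) : Matrix (Fin (j + 1)) (Fin (j + 1)) ℂ :=
  ∑ s, qrep j (unitStep s)

lemma stepSum_isHermitian (j : ℕ) : (stepSum j).IsHermitian := by
  have h : ∀ s, star (unitStep s) = unitStep (![1, 0, 3, 2, 5, 4] s) := by
    intro s
    fin_cases s <;> ext <;> simp [unitStep_re, unitStep_imI, unitStep_imJ, unitStep_imK]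
  rw [Matrix.IsHermitian, stepSum, Matrix.conjTranspose_sum]
  simp_rw [← qrep_star, h]
  simp only [Fin.sum_univ_six]
  simp
  abel

lemma sum_qrep_unitWalk (j L : ℕ) : ∑ w : Fin L → Fin 6, qrep j (unitWalk w) = stepSum j ^ L := by
  induction L with
  | zero => simp [unitWalk_zero, qrep_one]
  | succ L ih =>
    rw [sum_words_succ, pow_succ', ← ih, stepSum, Finset.sum_mul_sum]
    simp_rw [unitWalk_cons, qrep_mul]

lemma sum_cheb_unitWalk_mul (j L : ℕ) {g : ℍ[ℝ]} (hg : Quaternion.normSq g = 1) :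
    ((∑ w : Fin L → Fin 6, cheb (unitWalk w * g).re j : ℝ) : ℂ) =
      (stepSum j ^ L * qrep j g).trace := by
  rw [← sum_qrep_unitWalk, Finset.sum_mul, Matrix.trace_sum]
  push_cast
  refine Finset.sum_congr rfl fun w _ => ?_
  rw [← qrep_mul, trace_qrep]
  rw [map_mul, normSq_unitWalk, hg, one_mul]

/-- The eigenvalues of the averaging operator. -/
noncomputable def stepEig (j : ℕ) : Fin (j + 1) → ℝ := (stepSum_isHermitian j).eigenvalues

lemma exists_diagonalization (j : ℕ) : ∃ U ∈ Matrix.unitaryGroup (Fin (j + 1)) ℂ,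
    ∀ L, stepSum j ^ L = U * Matrix.diagonal (fun i => (stepEig j i : ℂ) ^ L) * star U := by
  refine ⟨(stepSum_isHermitian j).eigenvectorUnitary.1, SetLike.coe_mem _, fun L => ?_⟩
  set U : Matrix (Fin (j + 1)) (Fin (j + 1)) ℂ :=
    (stepSum_isHermitian j).eigenvectorUnitary.1
  have hU : star U * U = 1 :=
    Matrix.mem_unitaryGroup_iff'.1 (SetLike.coe_mem (stepSum_isHermitian j).eigenvectorUnitary)
  have hU' : U * star U = 1 :=
    Matrix.mem_unitaryGroup_iff.1 (SetLike.coe_mem (stepSum_isHermitian j).eigenvectorUnitary)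
  have h1 : stepSum j = U * Matrix.diagonal (fun i => (stepEig j i : ℂ)) * star U := by
    have := (stepSum_isHermitian j).spectral_theorem
    rw [Unitary.conjStarAlgAut_apply] at this
    exact this
  clear_value U
  induction L with
  | zero => simp [hU']
  | succ L ih =>
    rw [pow_succ, ih, h1]
    have h2 : Matrix.diagonal (fun i => (stepEig j i : ℂ) ^ (L + 1)) =
        Matrix.diagonal (fun i => (stepEig j i : ℂ) ^ L) *
          Matrix.diagonal (fun i => (stepEig j i : ℂ)) := by
      rw [Matrix.diagonal_mul_diagonal]; simp only [pow_succ]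
    rw [h2]
    calc _ = U * Matrix.diagonal (fun i => (stepEig j i : ℂ) ^ L) * (star U * U) *
          Matrix.diagonal (fun i => (stepEig j i : ℂ)) * star U := by simp only [mul_assoc]
      _ = _ := by rw [hU, mul_one]; simp only [mul_assoc]

lemma sum_cheb_unitWalk_eq_sum_eig (j L : ℕ) :
    ∑ w : Fin L → Fin 6, cheb (unitWalk w).re j = ∑ i, stepEig j i ^ L := by
  obtain ⟨U, hU, h⟩ := exists_diagonalization j
  have h1 := sum_cheb_unitWalk_mul j L (g := 1) (by simp)
  rw [h, qrep_one, mul_one, mul_assoc, Matrix.trace_mul_comm, mul_assoc,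
    Matrix.mem_unitaryGroup_iff'.1 hU, mul_one, Matrix.trace_diagonal] at h1
  simp only [mul_one] at h1
  exact_mod_cast h1

lemma abs_sum_cheb_unitWalk_mul_le (j L : ℕ) {g : ℍ[ℝ]} (hg : Quaternion.normSq g = 1) :
    |∑ w : Fin L → Fin 6, cheb (unitWalk w * g).re j| ≤ ∑ i, |stepEig j i| ^ L := by
  obtain ⟨U, hU, h⟩ := exists_diagonalization j
  have h1 := sum_cheb_unitWalk_mul j L hg
  set V := star U * qrep j g * U with hV
  have hVu : V ∈ Matrix.unitaryGroup (Fin (j + 1)) ℂ := by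
    have hq : qrep j g ∈ Matrix.unitaryGroup (Fin (j + 1)) ℂ :=
      Matrix.mem_unitaryGroup_iff'.2 (qrep_conjTranspose_mul_self j hg)
    exact mul_mem (mul_mem (Unitary.star_mem hU) hq) hU
  have h2 : (stepSum j ^ L * qrep j g).trace = ∑ i, (stepEig j i : ℂ) ^ L * V i i := by
    rw [h, mul_assoc, mul_assoc, Matrix.trace_mul_comm, mul_assoc, ← hV, Matrix.trace]
    simp only [Matrix.diag_apply, Matrix.diagonal_mul]
  rw [← Real.norm_eq_abs, ← Complex.norm_real, h1, h2]
  refine (norm_sum_le _ _).trans (Finset.sum_le_sum fun i _ => ?_)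
  rw [norm_mul, norm_pow, Complex.norm_real, Real.norm_eq_abs]
  exact mul_le_of_le_one_right (by positivity) (entry_norm_bound_of_unitary hVu _ _)

end BoxCounting

namespace BoxCounting

open Polynomial
open scoped Quaternion

/-! ### Strict contraction in each nontrivial representation -/

lemma sum_normSq_mulVec {n : ℕ} {A : Matrix (Fin n) (Fin n) ℂ} (hA : A.conjTranspose * A = 1)
    (v : Fin n → ℂ) : ∑ i, Complex.normSq ((A.mulVec v) i) = ∑ i, Complex.normSq (v i) := by
  have h : star (A.mulVec v) ⬝ᵥ A.mulVec v = star v ⬝ᵥ v := by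
    rw [Matrix.star_mulVec, Matrix.dotProduct_mulVec, Matrix.vecMul_vecMul, hA, Matrix.vecMul_one]
  have h' : ∀ u : Fin n → ℂ, star u ⬝ᵥ u = ((∑ i, Complex.normSq (u i) : ℝ) : ℂ) := by
    intro u
    simp only [dotProduct, Pi.star_apply]
    push_cast
    refine Finset.sum_congr rfl fun i _ => ?_
    rw [Complex.normSq_eq_conj_mul_self]; rfl
  rw [h', h'] at h
  exact_mod_cast h

lemma exists_stepEig_vector (j : ℕ) (i : Fin (j + 1)) : ∃ v : Fin (j + 1) → ℂ, v ≠ 0 ∧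
    (stepSum j).mulVec v = (stepEig j i : ℂ) • v := by
  refine ⟨(stepSum_isHermitian j).eigenvectorBasis i, ?_, ?_⟩
  · intro h
    have := (stepSum_isHermitian j).eigenvectorBasis.orthonormal.ne_zero i
    apply this
    ext k
    exact congrFun h k
  · have := (stepSum_isHermitian j).mulVec_eigenvectorBasis i
    rw [this]
    ext k
    simp [stepEig]

lemma sum_normSq_sub_eq {j : ℕ} {v : Fin (j + 1) → ℂ} {μ : ℝ}
    (hv : (stepSum j).mulVec v = (μ : ℂ) • v) {ε : ℝ} (hε : ε ^ 2 = 1) :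
    ∑ s, ∑ i, Complex.normSq ((qrep j (unitStep s)).mulVec v i - ε * v i) =
      (12 - 2 * (ε * μ)) * ∑ i, Complex.normSq (v i) := by
  have h1 : ∀ s, ∑ i, Complex.normSq ((qrep j (unitStep s)).mulVec v i - ε * v i) =
      2 * (∑ i, Complex.normSq (v i)) -
        2 * ε * ∑ i, ((qrep j (unitStep s)).mulVec v i * (starRingEnd ℂ) (v i)).re := by
    intro s
    have h2 := sum_normSq_mulVec (qrep_conjTranspose_mul_self j (normSq_unitStep s)) v
    simp only [Complex.normSq_sub, Complex.normSq_ofReal, map_mul,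
      Complex.conj_ofReal, Finset.sum_sub_distrib, Finset.sum_add_distrib]
    rw [h2, ← pow_two, hε, Finset.mul_sum (a := 2 * ε)]
    have h3 : ∀ i, 2 * ((qrep j (unitStep s)).mulVec v i * (ε * (starRingEnd ℂ) (v i))).re =
        2 * ε * ((qrep j (unitStep s)).mulVec v i * (starRingEnd ℂ) (v i)).re := by
      intro i
      rw [mul_left_comm, Complex.re_ofReal_mul]
      ring
    simp only [h3, one_mul]
    ring
  have h4 : ∑ s, ∑ i, ((qrep j (unitStep s)).mulVec v i * (starRingEnd ℂ) (v i)).re =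
      μ * ∑ i, Complex.normSq (v i) := by
    rw [Finset.sum_comm, Finset.mul_sum]
    refine Finset.sum_congr rfl fun i _ => ?_
    rw [← Complex.re_sum, ← Finset.sum_mul]
    have h5 : ∑ s, (qrep j (unitStep s)).mulVec v i = μ * v i := by
      have := congrFun hv i
      rw [stepSum, Matrix.sum_mulVec] at this
      simpa using this
    rw [h5, mul_assoc, Complex.mul_conj, ← Complex.ofReal_mul, Complex.ofReal_re]
  simp only [h1, Finset.sum_sub_distrib, ← Finset.mul_sum]
  rw [h4]
  simp
  ring

lemma sum_normSq_pos {n : ℕ} {v : Fin n → ℂ} (hv : v ≠ 0) : 0 < ∑ i, Complex.normSq (v i) := by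
  obtain ⟨i, hi⟩ := Function.ne_iff.1 hv
  exact Finset.sum_pos' (fun i _ => Complex.normSq_nonneg _)
    ⟨i, Finset.mem_univ _, Complex.normSq_pos.2 hi⟩

lemma gaussian_pow_im (k : ℕ) : ∃ A B : ℤ, (1 + 2 * Complex.I) ^ (k + 1) = A + B * Complex.I ∧
    5 ∣ B - 2 * A ∧ ¬ 5 ∣ A := by
  induction k with
  | zero => exact ⟨1, 2, by simp, by norm_num, by norm_num⟩
  | succ k ih =>
    obtain ⟨A, B, h, h1, h2⟩ := ih
    refine ⟨A - 2 * B, 2 * A + B, ?_, by omega, by omega⟩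
    rw [pow_succ, h]
    push_cast
    linear_combination 2 * (B : ℂ) * Complex.I_sq

/-- The eigenvalue of the first step of the walk. -/
noncomputable def stepRoot : ℂ := (√5 : ℂ)⁻¹ * (1 + 2 * Complex.I)

lemma stepRoot_pow_ne_one (k : ℕ) : stepRoot ^ (2 * (k + 1)) ≠ 1 := by
  intro h
  obtain ⟨A, B, h1, h2, h3⟩ := gaussian_pow_im (2 * k + 1)
  have h5 : (√5 : ℂ) ^ 2 = 5 := by
    rw [← Complex.ofReal_pow, Real.sq_sqrt (by norm_num)]; simp
  rw [stepRoot, mul_pow, inv_pow, pow_mul (√5 : ℂ), h5,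
    show 2 * (k + 1) = 2 * k + 1 + 1 by ring, h1] at h
  have h6 : (A : ℂ) + B * Complex.I = 5 ^ (k + 1) := by
    field_simp at h
    exact h
  have h7 := congrArg Complex.im h6
  have h8 : ((5 : ℂ) ^ (k + 1)).im = 0 := by
    have : (5 : ℂ) ^ (k + 1) = ((5 ^ (k + 1) : ℝ) : ℂ) := by push_cast; rfl
    rw [this, Complex.ofReal_im]
  rw [h8] at h7
  simp at h7
  subst h7
  omega

lemma stepRoot_ne_zero : stepRoot ≠ 0 := by
  intro h
  have h5 : (√5 : ℂ) ≠ 0 := by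
    rw [Ne, Complex.ofReal_eq_zero]; positivity
  rw [stepRoot, mul_eq_zero, or_iff_right (inv_ne_zero h5)] at h
  have := congrArg Complex.re h
  simp at this

lemma eq_of_stepRoot_sq_pow_eq {m n : ℕ} (h : stepRoot ^ (2 * m) = stepRoot ^ (2 * n)) :
    m = n := by
  wlog hmn : m ≤ n generalizing m n
  · exact (this h.symm (by omega)).symm
  by_contra hne
  obtain ⟨k, rfl⟩ : ∃ k, n = m + (k + 1) := ⟨n - m - 1, by omega⟩
  rw [mul_add, pow_add] at h
  have h2 := mul_left_cancel₀ (pow_ne_zero _ stepRoot_ne_zero)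
    (show stepRoot ^ (2 * m) * stepRoot ^ (2 * (k + 1)) = stepRoot ^ (2 * m) * 1 by
      rw [← h, mul_one])
  exact stepRoot_pow_ne_one k h2

lemma inv_sqrt_five : (√5 : ℝ)⁻¹ = √5 / 5 := by
  have h5 : √5 * √5 = (5 : ℝ) := Real.mul_self_sqrt (by norm_num)
  field_simp
  linarith

lemma toMat_unitStep_zero : toMat (unitStep 0) = !![stepRoot, 0; 0, stepRoot⁻¹] := by
  have h5 : (√5 : ℂ) ^ 2 = 5 := by
    rw [← Complex.ofReal_pow, Real.sq_sqrt (by norm_num)]; simp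
  have h5' : (√5 : ℂ) ≠ 0 := by
    rw [Ne, Complex.ofReal_eq_zero]; positivity
  have h : stepRoot⁻¹ = (√5 : ℂ)⁻¹ * (1 - 2 * Complex.I) := by
    apply inv_eq_of_mul_eq_one_right
    rw [stepRoot]
    field_simp
    rw [h5]
    linear_combination -4 * Complex.I_sq
  rw [h, stepRoot, toMat, unitStep_re, unitStep_imI, unitStep_imJ, unitStep_imK]
  ext i j
  fin_cases i <;> fin_cases j <;> simp [Complex.ext_iff, inv_sqrt_five]

lemma qrep_unitStep_zero_mulVec (j : ℕ) (v : Fin (j + 1) → ℂ) (i : Fin (j + 1)) :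
    (qrep j (unitStep 0)).mulVec v i =
      stepRoot ^ (i : ℕ) * stepRoot⁻¹ ^ (j - (i : ℕ)) * v i := by
  have h : ∀ k, qrep j (unitStep 0) i k =
      if k = i then stepRoot ^ (i : ℕ) * stepRoot⁻¹ ^ (j - (i : ℕ)) else 0 := by
    intro k
    rw [qrep, rep_apply, symPow, Matrix.of_apply, symRow, toMat_unitStep_zero]
    simp only [Matrix.of_apply, Matrix.cons_val', Matrix.cons_val_zero, Matrix.cons_val_one,
      Matrix.cons_val_fin_one, map_zero, add_zero, zero_mul, zero_add]
    rw [mul_pow, ← C_pow, ← C_pow, mul_right_comm (C _), ← C_mul, coeff_C_mul, coeff_X_pow]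
    by_cases hk : k = i
    · subst hk
      have := sqrt_choose_ne_zero (j := j) k
      simp
      field_simp
    · have : (k : ℕ) ≠ i := fun h => hk (Fin.ext h)
      simp [hk, this]
  simp only [Matrix.mulVec, dotProduct, h]
  simp

lemma qrep_unitStep_two_ne_zero (j : ℕ) (k : Fin (j + 1)) : qrep j (unitStep 2) 0 k ≠ 0 := by
  have h5 : (√5 : ℂ) ≠ 0 := by
    rw [Ne, Complex.ofReal_eq_zero]; positivity
  have h10 : toMat (unitStep 2) 1 0 = -((√5 : ℂ)⁻¹ * 2) := by
    simp [toMat, unitStep_imJ, unitStep_imK, Complex.ext_iff, inv_sqrt_five]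
  have h11 : toMat (unitStep 2) 1 1 = (√5 : ℂ)⁻¹ := by
    simp [toMat, unitStep_re, unitStep_imI, Complex.ext_iff, inv_sqrt_five]
  rw [qrep, rep_apply, symPow, Matrix.of_apply, symRow, h10, h11]
  have hk : (k : ℕ) ≤ j := by omega
  simp only [Fin.val_zero, pow_zero, one_mul, Nat.sub_zero]
  rw [coeff_linear_pow _ _ _ _ hk]
  have h1 := sqrt_choose_ne_zero (j := j) k
  have h2 := sqrt_choose_ne_zero (j := j) 0
  have h3 : ((j.choose k : ℕ) : ℂ) ≠ 0 := by exact_mod_cast (Nat.choose_pos hk).ne'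
  refine mul_ne_zero (mul_ne_zero h2 (mul_ne_zero (mul_ne_zero ?_ ?_) h3)) (inv_ne_zero h1)
  · exact pow_ne_zero _ (neg_ne_zero.2 (mul_ne_zero (inv_ne_zero h5) two_ne_zero))
  · exact pow_ne_zero _ (inv_ne_zero h5)

lemma eq_zero_of_forall_qrep_mulVec {l : ℕ} (hl : 1 ≤ l) {v : Fin (2 * l + 1) → ℂ} {ε : ℝ}
    (hε : ε ^ 2 = 1) (hv : ∀ s i, (qrep (2 * l) (unitStep s)).mulVec v i = ε * v i) : v = 0 := by
  have hε' : (ε : ℂ) ^ 2 = 1 := by exact_mod_cast hε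
  have hε0 : (ε : ℂ) ≠ 0 := by rintro h; simp [h] at hε'
  have h1 : ∀ i : Fin (2 * l + 1), (i : ℕ) ≠ l → v i = 0 := by
    intro i hi
    by_contra h0
    have h2 := hv 0 i
    rw [qrep_unitStep_zero_mulVec] at h2
    have h3 := mul_right_cancel₀ h0 h2
    have hr := stepRoot_ne_zero
    rw [inv_pow, ← div_eq_mul_inv, div_eq_iff (pow_ne_zero _ hr)] at h3
    have h4 : stepRoot ^ (2 * (i : ℕ)) = stepRoot ^ (2 * (2 * l - (i : ℕ))) := by
      rw [mul_comm 2, pow_mul, h3, mul_pow, hε', one_mul, ← pow_mul, mul_comm]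
    have := eq_of_stepRoot_sq_pow_eq h4
    omega
  have h0 : v 0 = 0 := h1 0 (by simp; omega)
  have h5 := hv 2 0
  rw [h0, mul_zero, Matrix.mulVec, dotProduct,
    Finset.sum_eq_single (⟨l, by omega⟩ : Fin (2 * l + 1))] at h5
  · have h6 := (mul_eq_zero.1 h5).resolve_left (qrep_unitStep_two_ne_zero _ _)
    ext i
    by_cases hi : (i : ℕ) = l
    · rw [show i = ⟨l, by omega⟩ from Fin.ext hi, h6]; rfl
    · exact h1 i hi
  · intro i _ hi
    rw [h1 i (fun h => hi (Fin.ext h)), mul_zero]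
  · simp

lemma mul_stepEig_lt {l : ℕ} (hl : 1 ≤ l) (i : Fin (2 * l + 1)) {ε : ℝ} (hε : ε ^ 2 = 1) :
    ε * stepEig (2 * l) i < 6 := by
  obtain ⟨v, hv, h⟩ := exists_stepEig_vector (2 * l) i
  have h1 := sum_normSq_sub_eq h hε
  have h2 := sum_normSq_pos hv
  have h3 : ∀ s, ∀ k, 0 ≤ Complex.normSq ((qrep (2 * l) (unitStep s)).mulVec v k - ε * v k) :=
    fun s k => Complex.normSq_nonneg _
  by_contra! h4
  have h5 : ∑ s, ∑ k, Complex.normSq ((qrep (2 * l) (unitStep s)).mulVec v k - ε * v k) = 0 := by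
    apply le_antisymm
    · rw [h1]
      exact mul_nonpos_of_nonpos_of_nonneg (by linarith) h2.le
    · exact Finset.sum_nonneg fun s _ => Finset.sum_nonneg fun k _ => h3 s k
  refine hv (eq_zero_of_forall_qrep_mulVec hl hε fun s k => ?_)
  have h6 := (Finset.sum_eq_zero_iff_of_nonneg
    (fun s _ => Finset.sum_nonneg fun k _ => h3 s k)).1 h5 s (Finset.mem_univ _)
  have h7 := (Finset.sum_eq_zero_iff_of_nonneg (fun k _ => h3 s k)).1 h6 k (Finset.mem_univ _)
  exact sub_eq_zero.1 (Complex.normSq_eq_zero.1 h7)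

lemma abs_stepEig_lt {l : ℕ} (hl : 1 ≤ l) (i : Fin (2 * l + 1)) : |stepEig (2 * l) i| < 6 := by
  have h1 := mul_stepEig_lt hl i (ε := 1) (by norm_num)
  have h2 := mul_stepEig_lt hl i (ε := -1) (by norm_num)
  rw [abs_lt]
  constructor <;> linarith

end BoxCounting

namespace BoxCounting

open scoped Quaternion

/-! ### The uniform spectral gap -/

lemma exists_stepEig_pow_le : ∃ C > 0, ∀ (M l : ℕ) (i : Fin (2 * l + 1)),
    ((l : ℝ) + 1) ^ 2 / 2 * stepEig (2 * l) i ^ (2 * M) ≤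
      2 * ((l : ℝ) + 1) ^ 4 * ((M + 1) * 20 ^ M) + C * ((l : ℝ) + 1) * (11 / 10) ^ M * 36 ^ M := by
  obtain ⟨C, hC, h⟩ := exists_sum_walk_cheb_pow_four_le
  refine ⟨C, hC, fun M l i => ?_⟩
  have h1 := h M l
  have h2 := mul_sum_cheb_le (fun w : Fin (2 * M) → Fin 6 => (unitWalk w).re) (fun k => by
    rw [sum_cheb_unitWalk_eq_sum_eig]
    exact Finset.sum_nonneg fun i _ => by rw [pow_mul]; positivity) l
  simp only [sum_cheb_unitWalk_eq_sum_eig] at h2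
  simp only [unitWalk_re_two_mul] at h2
  refine le_trans ?_ (h2.trans h1)
  gcongr
  exact Finset.single_le_sum (f := fun i => stepEig (2 * l) i ^ (2 * M))
    (fun i _ => by simp only [pow_mul]; positivity) (Finset.mem_univ i)

lemma pow_le_of_dyadic {C t y : ℝ} (hC : 0 < C) {n : ℕ} (hy1 : 2 ^ n ≤ y)
    (hy2 : y ≤ 2 * 2 ^ n)
    (h : y ^ 2 / 2 * (t * 6) ^ (2 * (5 * n)) ≤ 2 * y ^ 4 * (((5 * n : ℕ) + 1) * 20 ^ (5 * n)) +
      C * y * (11 / 10) ^ (5 * n) * 36 ^ (5 * n)) :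
    (t ^ 10) ^ n ≤ (80 + 2 * C) * (81 / 100) ^ n := by
  have hy : 0 < y := lt_of_lt_of_le (by positivity) hy1
  have h36 : (0 : ℝ) < 36 ^ (5 * n) := by positivity
  have h1 : (t ^ 10) ^ n ≤ 4 * y ^ 2 * ((5 * n : ℕ) + 1) * (5 / 9) ^ (5 * n) +
      2 * C / y * (11 / 10) ^ (5 * n) := by
    have e1 : (t * 6) ^ (2 * (5 * n)) = (t ^ 10) ^ n * 36 ^ (5 * n) := by
      rw [mul_pow, pow_mul 6 2, ← pow_mul t]
      norm_num
      congr 1; ring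
    have e2 : (5 / 9 : ℝ) ^ (5 * n) * 36 ^ (5 * n) = 20 ^ (5 * n) := by
      rw [← mul_pow]; norm_num
    rw [e1, ← e2] at h
    have h2 : (t ^ 10) ^ n * (y ^ 2 / 2 * 36 ^ (5 * n)) ≤
        (4 * y ^ 2 * ((5 * n : ℕ) + 1) * (5 / 9) ^ (5 * n) +
        2 * C / y * (11 / 10) ^ (5 * n)) * (y ^ 2 / 2 * 36 ^ (5 * n)) := by
      calc _ = y ^ 2 / 2 * ((t ^ 10) ^ n * 36 ^ (5 * n)) := by ring
        _ ≤ _ := h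
        _ = _ := by field_simp; ring
    exact le_of_mul_le_mul_right h2 (by positivity)
  have h5n : (((5 * n : ℕ) : ℝ) + 1) ≤ 5 * 2 ^ n := by
    have : 5 * n + 1 ≤ 5 * 2 ^ n := by
      have := Nat.lt_two_pow_self (n := n)
      omega
    exact_mod_cast this
  refine h1.trans ?_
  have h3 : 4 * y ^ 2 * ((5 * n : ℕ) + 1) * (5 / 9) ^ (5 * n) ≤ 80 * (81 / 100) ^ n := by
    calc 4 * y ^ 2 * ((5 * n : ℕ) + 1) * (5 / 9) ^ (5 * n)
        ≤ 4 * (2 * 2 ^ n) ^ 2 * (5 * 2 ^ n) * (5 / 9) ^ (5 * n) := by gcongr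
      _ = 80 * (8 * (5 / 9) ^ 5) ^ n := by
        rw [mul_pow 8, ← pow_mul, show (8 : ℝ) = 2 ^ 3 by norm_num, ← pow_mul]; ring
      _ ≤ _ := by gcongr; norm_num
  have h4 : 2 * C / y * (11 / 10) ^ (5 * n) ≤ 2 * C * (81 / 100) ^ n := by
    calc 2 * C / y * (11 / 10) ^ (5 * n) ≤ 2 * C / 2 ^ n * (11 / 10) ^ (5 * n) := by gcongr
      _ = 2 * C * ((11 / 10) ^ 5 / 2) ^ n := by rw [div_pow _ (2 : ℝ), ← pow_mul]; ring
      _ ≤ _ := mul_le_mul_of_nonneg_left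
        (pow_le_pow_left₀ (by positivity) (by norm_num) n) (by positivity)
  linarith

lemma exists_forall_large_abs_stepEig_le : ∃ N : ℕ, ∀ l, N ≤ l → ∀ i,
    |stepEig (2 * l) i| ≤ 6 * (99 / 100) := by
  obtain ⟨C, hC, h⟩ := exists_stepEig_pow_le
  obtain ⟨n₀, hn₀⟩ := exists_pow_lt_of_lt_one (show 0 < 1 / (80 + 2 * C) by positivity)
    (show (9 / 10 : ℝ) < 1 by norm_num)
  refine ⟨2 ^ (n₀ + 1), fun l hl i => ?_⟩
  set n := Nat.log 2 (l + 1) with hn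
  have hnn : n₀ + 1 ≤ n := Nat.le_log_of_pow_le (by norm_num) (by omega)
  have hy1 : 2 ^ n ≤ l + 1 := Nat.pow_log_le_self 2 (by omega)
  have hy2 : l + 1 ≤ 2 * 2 ^ n := by
    have := Nat.lt_pow_succ_log_self (b := 2) (by norm_num) (l + 1)
    rw [← hn, pow_succ] at this
    omega
  have h1 := h (5 * n) l i
  have h2 : stepEig (2 * l) i ^ (2 * (5 * n)) =
      (|stepEig (2 * l) i| / 6 * 6) ^ (2 * (5 * n)) := by
    rw [div_mul_cancel₀ _ (by norm_num), pow_mul, pow_mul |_|, sq_abs]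
  rw [h2] at h1
  have h3 := pow_le_of_dyadic hC (by exact_mod_cast hy1) (by exact_mod_cast hy2) h1
  have h4 : (80 + 2 * C) * (81 / 100) ^ n ≤ (9 / 10 : ℝ) ^ n := by
    have h5 : (9 / 10 : ℝ) ^ n ≤ 1 / (80 + 2 * C) :=
      (pow_le_pow_of_le_one (by norm_num) (by norm_num) (by omega)).trans hn₀.le
    rw [le_div_iff₀ (by positivity)] at h5
    calc (80 + 2 * C) * (81 / 100) ^ n = (9 / 10 : ℝ) ^ n * (80 + 2 * C) * (9 / 10) ^ n := by
          rw [show (81 / 100 : ℝ) = 9 / 10 * (9 / 10) by norm_num, mul_pow]; ring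
      _ ≤ 1 * (9 / 10) ^ n := by gcongr
      _ = _ := one_mul _
  have h6 : (|stepEig (2 * l) i| / 6) ^ 10 ≤ 9 / 10 :=
    le_of_pow_le_pow_left₀ (by omega : n ≠ 0) (by norm_num) (h3.trans h4)
  have h7 : |stepEig (2 * l) i| / 6 ≤ 99 / 100 := by
    apply le_of_pow_le_pow_left₀ (by norm_num : 10 ≠ 0) (by norm_num)
    exact h6.trans (by norm_num)
  linarith

lemma exists_forall_lt_abs_stepEig_le (N : ℕ) : ∃ c : ℝ, 0 ≤ c ∧ c < 1 ∧ ∀ l, 1 ≤ l → l < N →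
    ∀ i, |stepEig (2 * l) i| ≤ 6 * c := by
  induction N with
  | zero => exact ⟨0, le_rfl, one_pos, fun l _ h => absurd h (by omega)⟩
  | succ N ih =>
    obtain ⟨c, hc0, hc1, hc⟩ := ih
    rcases Nat.eq_zero_or_pos N with rfl | hN
    · exact ⟨0, le_rfl, one_pos, fun l _ h => by omega⟩
    obtain ⟨k, hk⟩ := Finite.exists_max fun i => |stepEig (2 * N) i|
    have hk' := abs_stepEig_lt hN k
    refine ⟨max c (|stepEig (2 * N) k| / 6), le_max_of_le_left hc0, max_lt hc1 (by linarith),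
      fun l hl hlN i => ?_⟩
    rcases Nat.lt_succ_iff_lt_or_eq.1 hlN with h | rfl
    · exact (hc l hl h i).trans (by gcongr; exact le_max_left _ _)
    · have := le_max_right c (|stepEig (2 * l) k| / 6)
      have := hk i
      linarith

lemma exists_forall_abs_stepEig_le : ∃ c : ℝ, 0 ≤ c ∧ c < 1 ∧ ∀ l, 1 ≤ l →
    ∀ i, |stepEig (2 * l) i| ≤ 6 * c := by
  obtain ⟨N, hN⟩ := exists_forall_large_abs_stepEig_le
  obtain ⟨c, hc0, hc1, hc⟩ := exists_forall_lt_abs_stepEig_le N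
  refine ⟨max c (99 / 100), le_max_of_le_left hc0, max_lt hc1 (by norm_num), fun l hl i => ?_⟩
  rcases lt_or_ge l N with h | h
  · exact (hc l hl h i).trans (by gcongr; exact le_max_left _ _)
  · exact (hN l h i).trans (by gcongr; exact le_max_right _ _)

/-- The spectral gap: the walk equidistributes exponentially fast in every nontrivial even
representation, with a rate independent of the representation. -/
lemma exists_abs_sum_cheb_unitWalk_mul_le : ∃ c : ℝ, 0 ≤ c ∧ c < 1 ∧ ∀ l, 1 ≤ l → ∀ L : ℕ,
    ∀ g : ℍ[ℝ], Quaternion.normSq g = 1 →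
      |∑ w : Fin L → Fin 6, cheb (unitWalk w * g).re (2 * l)| ≤ (2 * l + 1) * (6 * c) ^ L := by
  obtain ⟨c, hc0, hc1, hc⟩ := exists_forall_abs_stepEig_le
  refine ⟨c, hc0, hc1, fun l hl L g hg => (abs_sum_cheb_unitWalk_mul_le _ _ hg).trans ?_⟩
  calc ∑ i, |stepEig (2 * l) i| ^ L ≤ ∑ _i : Fin (2 * l + 1), (6 * c) ^ L :=
        Finset.sum_le_sum fun i _ => pow_le_pow_left₀ (abs_nonneg _) (hc l hl i) L
    _ = _ := by simp

end BoxCounting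

namespace BoxCounting

open scoped Quaternion

/-! ### Density of the walk in the unit quaternions -/

lemma le_sum_cheb_mul {ι : Type*} [Fintype ι] (x : ι → ℝ) {K : ℕ} {B : ℝ} (hB : 0 ≤ B)
    (h : ∀ k, 1 ≤ k → k ≤ 2 * K → -B ≤ ∑ w, cheb (x w) (2 * k)) {i j : ℕ} (hij : i ≤ j)
    (hj : j ≤ K) : (if i = j then (Fintype.card ι : ℝ) else 0) - (2 * K + 1) * B ≤
      ∑ w, cheb (x w) (2 * i) * cheb (x w) (2 * j) := by
  rw [sum_cheb_mul_of_le x hij, Finset.sum_range_succ']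
  have h1 : -((2 * K : ℕ) * B) ≤
      ∑ c ∈ Finset.range (2 * i), ∑ w, cheb (x w) (2 * (j - i + (c + 1))) := by
    calc -((2 * K : ℕ) * B) ≤ -((2 * i : ℕ) * B) := by gcongr; omega
      _ = ∑ c ∈ Finset.range (2 * i), -B := by simp
      _ ≤ _ := Finset.sum_le_sum fun c hc => h _ (by omega) (by
          have := Finset.mem_range.1 hc; omega)
  have h2 : (if i = j then (Fintype.card ι : ℝ) else 0) - B ≤
      ∑ w, cheb (x w) (2 * (j - i + 0)) := by
    split_ifs with hc
    · subst hc
      simp [cheb, hB]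
    · rw [zero_sub]
      exact h _ (by omega) (by omega)
  push_cast at h1
  linarith

lemma le_sum_cheb_pow_four {ι : Type*} [Fintype ι] (x : ι → ℝ) {K : ℕ} {B : ℝ} (hB : 0 ≤ B)
    (h : ∀ k, 1 ≤ k → k ≤ 2 * K → -B ≤ ∑ w, cheb (x w) (2 * k)) :
    ((K : ℝ) + 1) * Fintype.card ι - ((K : ℝ) + 1) ^ 2 * ((2 * K + 1) * B) ≤
      ∑ w, cheb (x w) K ^ 4 := by
  have h1 : ∀ i ∈ Finset.range (K + 1), ∀ j ∈ Finset.range (K + 1),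
      (if i = j then (Fintype.card ι : ℝ) else 0) - (2 * K + 1) * B ≤
        ∑ w, cheb (x w) (2 * i) * cheb (x w) (2 * j) := by
    intro i hi j hj
    rw [Finset.mem_range] at hi hj
    rcases le_total i j with hij | hij
    · exact le_sum_cheb_mul x hB h hij (by omega)
    · simp_rw [mul_comm (cheb _ (2 * i)), eq_comm (a := i)]
      exact le_sum_cheb_mul x hB h hij (by omega)
  rw [sum_cheb_pow_four]
  refine le_trans (le_of_eq ?_) (Finset.sum_le_sum fun i hi => Finset.sum_le_sum (h1 i hi))
  have h2 : ∀ i ∈ Finset.range (K + 1), ∑ j ∈ Finset.range (K + 1),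
      ((if i = j then (Fintype.card ι : ℝ) else 0) - (2 * K + 1) * B) =
      Fintype.card ι - (K + 1) * ((2 * K + 1) * B) := by
    intro i hi
    rw [Finset.sum_sub_distrib, Finset.sum_ite_eq, if_pos hi]
    simp
  rw [Finset.sum_congr rfl h2]
  simp
  ring

/-- The walk becomes exponentially dense in the unit quaternions, up to sign. -/
lemma exists_unitWalk_mul_close : ∃ c : ℕ, ∀ (n : ℕ) (q : ℍ[ℝ]), Quaternion.normSq q = 1 →
    ∃ w : Fin (c * n) → Fin 6, 1 - (unitWalk w * q).re ^ 2 ≤ (1 / 4) ^ n := by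
  obtain ⟨r, hr0, hr1, hr⟩ := exists_abs_sum_cheb_unitWalk_mul_le
  obtain ⟨c, hc⟩ := exists_pow_lt_of_lt_one (show (0 : ℝ) < 1 / 65536 / 405 by norm_num) hr1
  refine ⟨c, fun n q hq => ?_⟩
  rcases Nat.eq_zero_or_pos n with rfl | hn
  · exact ⟨fun _ => 0, by simpa using sq_nonneg _⟩
  by_contra! hcon
  set K := 2 * 16 ^ n with hK
  set x : (Fin (c * n) → Fin 6) → ℝ := fun w => (unitWalk w * q).re with hx
  have h6 : (0 : ℝ) < 6 ^ (c * n) := by positivity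
  have hcard : (Fintype.card (Fin (c * n) → Fin 6) : ℝ) = 6 ^ (c * n) := by simp
  have hup : ∑ w, cheb (x w) K ^ 4 ≤ 6 ^ (c * n) * 16 ^ n := by
    calc ∑ w, cheb (x w) K ^ 4 ≤ ∑ _w : Fin (c * n) → Fin 6, (16 : ℝ) ^ n := by
          refine Finset.sum_le_sum fun w _ => ?_
          have h1 := cheb_sq_mul_le (x w) K
          have h2 : (1 / 4 : ℝ) ^ n < 1 - x w ^ 2 := hcon w
          have h3 : cheb (x w) K ^ 2 * (1 / 4) ^ n ≤ 1 :=
            le_trans (mul_le_mul_of_nonneg_left h2.le (sq_nonneg _)) h1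
          have h4 : cheb (x w) K ^ 2 ≤ 4 ^ n := by
            rw [one_div, inv_pow, ← div_eq_mul_inv, div_le_iff₀ (by positivity), one_mul] at h3
            exact h3
          calc cheb (x w) K ^ 4 = (cheb (x w) K ^ 2) ^ 2 := by ring
            _ ≤ (4 ^ n) ^ 2 := pow_le_pow_left₀ (sq_nonneg _) h4 2
            _ = 16 ^ n := by rw [← pow_mul, mul_comm, pow_mul]; norm_num
      _ = _ := by simp
  have hlow := le_sum_cheb_pow_four x (K := K) (B := (4 * K + 1) * (6 * r) ^ (c * n))
    (by positivity) (by
      intro k hk1 hk2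
      have h1 := (abs_le.1 (hr k hk1 (c * n) q hq)).1
      refine le_trans ?_ h1
      have : (k : ℝ) ≤ 2 * K := by exact_mod_cast hk2
      exact neg_le_neg (mul_le_mul_of_nonneg_right (by linarith) (by positivity)))
  rw [hcard] at hlow
  have h16 : (1 : ℝ) ≤ 16 ^ n := one_le_pow₀ (by norm_num)
  have hKr : (K : ℝ) = 2 * 16 ^ n := by rw [hK]; push_cast; rfl
  have hsmall : ((K : ℝ) + 1) ^ 2 * ((2 * K + 1) * ((4 * K + 1) * r ^ (c * n))) ≤ 1 := by
    calc ((K : ℝ) + 1) ^ 2 * ((2 * K + 1) * ((4 * K + 1) * r ^ (c * n)))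
        ≤ (3 * 16 ^ n) ^ 2 * ((5 * 16 ^ n) * ((9 * 16 ^ n) * (1 / 65536 / 405) ^ n)) := by
          rw [pow_mul]
          gcongr <;> linarith
      _ = 405 * (1 / 405) ^ n := by
          have e : (1 / 65536 / 405 : ℝ) ^ n = (1 / 405) ^ n / (16 ^ n) ^ 4 := by
            rw [← pow_mul, mul_comm n, pow_mul, ← div_pow]; norm_num
          rw [e]
          field_simp
          ring
      _ ≤ 405 * (1 / 405) ^ 1 := mul_le_mul_of_nonneg_left
          (pow_le_pow_of_le_one (by norm_num) (by norm_num) hn) (by norm_num)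
      _ = 1 := by norm_num
  have h7 := hlow.trans hup
  rw [mul_pow 6 r] at h7
  have h8 : (6 : ℝ) ^ (c * n) * ((K + 1) -
      ((K : ℝ) + 1) ^ 2 * ((2 * K + 1) * ((4 * K + 1) * r ^ (c * n)))) ≤
      6 ^ (c * n) * 16 ^ n := by linarith
  have h9 := le_of_mul_le_mul_left h8 h6
  linarith

end BoxCounting

namespace BoxCounting

open scoped Quaternion

/-! ### Rotations -/

/-- The rotation of `ℝ³` associated with a unit quaternion. -/
def rot3 (q : ℍ[ℝ]) : Matrix (Fin 3) (Fin 3) ℝ :=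
  !![q.re ^ 2 + q.imI ^ 2 - q.imJ ^ 2 - q.imK ^ 2, 2 * (q.imI * q.imJ - q.re * q.imK),
      2 * (q.imI * q.imK + q.re * q.imJ);
    2 * (q.imI * q.imJ + q.re * q.imK), q.re ^ 2 - q.imI ^ 2 + q.imJ ^ 2 - q.imK ^ 2,
      2 * (q.imJ * q.imK - q.re * q.imI);
    2 * (q.imI * q.imK - q.re * q.imJ), 2 * (q.imJ * q.imK + q.re * q.imI),
      q.re ^ 2 - q.imI ^ 2 - q.imJ ^ 2 + q.imK ^ 2]

lemma rot3_mul (p q : ℍ[ℝ]) : rot3 (p * q) = rot3 p * rot3 q := by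
  ext i j
  fin_cases i <;> fin_cases j <;> simp [rot3, Matrix.mul_apply, Fin.sum_univ_three] <;> ring

lemma rot3_one : rot3 1 = 1 := by
  ext i j
  fin_cases i <;> fin_cases j <;> simp [rot3]

lemma rot3_star (q : ℍ[ℝ]) : rot3 (star q) = (rot3 q).transpose := by
  ext i j
  fin_cases i <;> fin_cases j <;> simp [rot3] <;> ring

lemma det_rot3 {q : ℍ[ℝ]} (hq : Quaternion.normSq q = 1) : (rot3 q).det = 1 := by
  have h : (rot3 q).det = Quaternion.normSq q ^ 3 := by
    rw [Matrix.det_fin_three, Quaternion.normSq_def']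
    simp [rot3]
    ring
  rw [h, hq, one_pow]

lemma sum_rot3_mulVec_sub_sq_le {q : ℍ[ℝ]} (hq : Quaternion.normSq q = 1) (v : Fin 3 → ℝ) :
    ∑ i, ((rot3 q).mulVec v i - v i) ^ 2 ≤ 4 * (1 - q.re ^ 2) * ∑ i, v i ^ 2 := by
  rw [Quaternion.normSq_def'] at hq
  have h : ∑ i, ((rot3 q).mulVec v i - v i) ^ 2 =
      4 * (1 - q.re ^ 2) * ∑ i, v i ^ 2 - 4 * (q.imI * v 0 + q.imJ * v 1 + q.imK * v 2) ^ 2 := by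
    have e : ∀ i, (rot3 q).mulVec v i - v i = (rot3 q).mulVec v i -
        (q.re ^ 2 + q.imI ^ 2 + q.imJ ^ 2 + q.imK ^ 2) * v i := by intro i; rw [hq, one_mul]
    have e2 : 1 - q.re ^ 2 = q.imI ^ 2 + q.imJ ^ 2 + q.imK ^ 2 := by linarith
    have e3 : ∑ i, ((rot3 q).mulVec v i - v i) ^ 2 =
      (q.re ^ 2 + q.imI ^ 2 + q.imJ ^ 2 + q.imK ^ 2) *
      (4 * (q.imI ^ 2 + q.imJ ^ 2 + q.imK ^ 2) * ∑ i, v i ^ 2 -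
        4 * (q.imI * v 0 + q.imJ * v 1 + q.imK * v 2) ^ 2) := by
      simp only [e]
      simp [rot3, Matrix.mulVec, dotProduct, Fin.sum_univ_three]
      ring
    rw [e3, hq, e2, one_mul]
  rw [h]
  nlinarith [sq_nonneg (q.imI * v 0 + q.imJ * v 1 + q.imK * v 2)]

variable {m : ℕ}

/-- The coordinates on which the rotations with index `i` act come first. -/
def frame (i : Fin (3 + m)) : Fin 3 ⊕ Fin m ≃ Fin (3 + m) :=
  finSumFinEquiv.trans (Equiv.swap (Fin.castAdd m 1) i)

/-- The rotation associated with a unit quaternion, acting on three of the coordinates. -/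
def rot (i : Fin (3 + m)) (q : ℍ[ℝ]) : Matrix (Fin (3 + m)) (Fin (3 + m)) ℝ :=
  (Matrix.fromBlocks (rot3 q) 0 0 1).submatrix (frame i).symm (frame i).symm

lemma rot_mul (i : Fin (3 + m)) (p q : ℍ[ℝ]) : rot i (p * q) = rot i p * rot i q := by
  rw [rot, rot, rot, Matrix.submatrix_mul_equiv, Matrix.fromBlocks_multiply, rot3_mul]
  simp

lemma rot_one (i : Fin (3 + m)) : rot i 1 = 1 := by
  rw [rot, rot3_one, Matrix.fromBlocks_one, Matrix.submatrix_one_equiv]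

lemma rot_star (i : Fin (3 + m)) (q : ℍ[ℝ]) : rot i (star q) = (rot i q).transpose := by
  rw [rot, rot, Matrix.transpose_submatrix, Matrix.fromBlocks_transpose, rot3_star]
  simp

lemma rot_mem_orthogonalGroup (i : Fin (3 + m)) {q : ℍ[ℝ]} (hq : Quaternion.normSq q = 1) :
    rot i q ∈ Matrix.orthogonalGroup (Fin (3 + m)) ℝ := by
  rw [Matrix.mem_orthogonalGroup_iff']
  rw [← rot_star, ← rot_mul, Quaternion.star_mul_self, hq, ← rot_one i]
  rfl

lemma det_rot (i : Fin (3 + m)) {q : ℍ[ℝ]} (hq : Quaternion.normSq q = 1) :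
    (rot i q).det = 1 := by
  rw [rot, Matrix.det_submatrix_equiv_self, Matrix.det_fromBlocks_zero₂₁, det_rot3 hq,
    Matrix.det_one, one_mul]

lemma rot_mulVec_inl (i : Fin (3 + m)) (q : ℍ[ℝ]) (x : Fin (3 + m) → ℝ) (k : Fin 3) :
    (rot i q).mulVec x (frame i (Sum.inl k)) =
      (rot3 q).mulVec (fun l => x (frame i (Sum.inl l))) k := by
  rw [rot, Matrix.submatrix_mulVec_equiv, Matrix.fromBlocks_mulVec]
  simp
  rfl

lemma rot_mulVec_inr (i : Fin (3 + m)) (q : ℍ[ℝ]) (x : Fin (3 + m) → ℝ) (k : Fin m) :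
    (rot i q).mulVec x (frame i (Sum.inr k)) = x (frame i (Sum.inr k)) := by
  rw [rot, Matrix.submatrix_mulVec_equiv, Matrix.fromBlocks_mulVec]
  simp

lemma sum_frame (i : Fin (3 + m)) (f : Fin (3 + m) → ℝ) :
    ∑ j, f j = ∑ k, f (frame i (Sum.inl k)) + ∑ k, f (frame i (Sum.inr k)) := by
  rw [← Equiv.sum_comp (frame i), Fintype.sum_sum_type]

lemma sum_rot_mulVec_sub_sq_le (i : Fin (3 + m)) {q : ℍ[ℝ]} (hq : Quaternion.normSq q = 1)
    (x : Fin (3 + m) → ℝ) :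
    ∑ j, ((rot i q).mulVec x j - x j) ^ 2 ≤ 4 * (1 - q.re ^ 2) * ∑ j, x j ^ 2 := by
  have hre : q.re ^ 2 ≤ 1 := by
    rw [Quaternion.normSq_def'] at hq
    nlinarith [sq_nonneg q.imI, sq_nonneg q.imJ, sq_nonneg q.imK]
  rw [sum_frame i, sum_frame i]
  simp only [rot_mulVec_inl, rot_mulVec_inr, sub_self]
  have h1 := sum_rot3_mulVec_sub_sq_le hq fun l => x (frame i (Sum.inl l))
  have h2 : 0 ≤ ∑ k, x (frame i (Sum.inr k)) ^ 2 := Finset.sum_nonneg fun _ _ => sq_nonneg _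
  simp
  nlinarith

lemma sum_mulVec_sq {n : ℕ} {A : Matrix (Fin n) (Fin n) ℝ}
    (hA : A ∈ Matrix.orthogonalGroup (Fin n) ℝ) (x : Fin n → ℝ) :
    ∑ i, A.mulVec x i ^ 2 = ∑ i, x i ^ 2 := by
  have h : A.mulVec x ⬝ᵥ A.mulVec x = x ⬝ᵥ x := by
    rw [Matrix.dotProduct_mulVec, Matrix.vecMul_mulVec]
    rw [(Matrix.mem_orthogonalGroup_iff' _ _).1 hA, Matrix.vecMul_one]
  simpa only [dotProduct, ← pow_two] using h

end BoxCounting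

namespace BoxCounting

open scoped Quaternion

/-! ### Approximating rotations by words in the generators -/

/-- The Euclidean norm. -/
noncomputable def nrm {n : ℕ} (v : Fin n → ℝ) : ℝ := √(∑ i, v i ^ 2)

lemma nrm_add_le {n : ℕ} (u v : Fin n → ℝ) : nrm (u + v) ≤ nrm u + nrm v := by
  have h := norm_add_le (WithLp.toLp 2 u : EuclideanSpace ℝ (Fin n)) (WithLp.toLp 2 v)
  simpa [EuclideanSpace.norm_eq, nrm] using h

lemma abs_apply_le_nrm {n : ℕ} (v : Fin n → ℝ) (i : Fin n) : |v i| ≤ nrm v := by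
  apply Real.abs_le_sqrt
  exact Finset.single_le_sum (f := fun i => v i ^ 2) (fun i _ => sq_nonneg _) (Finset.mem_univ i)

lemma nrm_mulVec {n : ℕ} {A : Matrix (Fin n) (Fin n) ℝ}
    (hA : A ∈ Matrix.orthogonalGroup (Fin n) ℝ) (x : Fin n → ℝ) : nrm (A.mulVec x) = nrm x := by
  rw [nrm, nrm, sum_mulVec_sq hA]

variable {m : ℕ}

/-- The generating rotations. -/
noncomputable def gen (s : Fin (3 + m) × Fin 6) : Matrix (Fin (3 + m)) (Fin (3 + m)) ℝ :=
  rot s.1 (unitStep s.2)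

lemma gen_mem (s : Fin (3 + m) × Fin 6) : gen s ∈ Matrix.orthogonalGroup (Fin (3 + m)) ℝ :=
  rot_mem_orthogonalGroup _ (normSq_unitStep _)

/-- The product of a word in the generators. -/
noncomputable def wordMat (l : List (Fin (3 + m) × Fin 6)) :
    Matrix (Fin (3 + m)) (Fin (3 + m)) ℝ :=
  (l.map gen).prod

lemma wordMat_mem (l : List (Fin (3 + m) × Fin 6)) :
    wordMat l ∈ Matrix.orthogonalGroup (Fin (3 + m)) ℝ := by
  refine Submonoid.list_prod_mem _ fun A hA => ?_
  obtain ⟨s, _, rfl⟩ := List.mem_map.1 hA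
  exact gen_mem s

lemma det_wordMat (l : List (Fin (3 + m) × Fin 6)) : (wordMat l).det = 1 := by
  induction l with
  | nil => simp [wordMat]
  | cons s l ih =>
    rw [wordMat, List.map_cons, List.prod_cons, Matrix.det_mul, gen, det_rot _ (normSq_unitStep _),
      one_mul]
    exact ih

lemma wordMat_append (l l' : List (Fin (3 + m) × Fin 6)) :
    wordMat (l ++ l') = wordMat l * wordMat l' := by
  simp [wordMat]

lemma wordMat_ofFn {L : ℕ} (i : Fin (3 + m)) (w : Fin L → Fin 6) :
    wordMat (List.ofFn fun k => (i, w k)) = rot i (unitWalk w) := by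
  induction L with
  | zero => simp [wordMat, unitWalk_zero, rot_one]
  | succ L ih =>
    rw [List.ofFn_succ, ← Fin.cons_self_tail w, unitWalk_cons, rot_mul, ← ih, wordMat,
      List.map_cons, List.prod_cons]
    rfl

/-- The vector `y` is approached exponentially fast by the words applied to `x`. -/
def Reach (c N : ℕ) (x y : Fin (3 + m) → ℝ) : Prop :=
  ∀ n : ℕ, ∃ l : List (Fin (3 + m) × Fin 6), l.length = N * (c * n) ∧
    nrm ((wordMat l).mulVec x - y) ≤ N * (2 * (1 / 2) ^ n)

lemma Reach.zero (c : ℕ) (x : Fin (3 + m) → ℝ) : Reach c 0 x x :=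
  fun n => ⟨[], by simp, by simp [wordMat, nrm]⟩

lemma Reach.trans {c N N' : ℕ} {x y z : Fin (3 + m) → ℝ} (h : Reach c N x y)
    (h' : Reach c N' y z) : Reach c (N + N') x z := by
  intro n
  obtain ⟨l, hl, hlx⟩ := h n
  obtain ⟨l', hl', hly⟩ := h' n
  refine ⟨l' ++ l, by rw [List.length_append, hl, hl']; ring, ?_⟩
  have e : (wordMat (l' ++ l)).mulVec x - z =
      (wordMat l').mulVec ((wordMat l).mulVec x - y) + ((wordMat l').mulVec y - z) := by
    rw [wordMat_append, Matrix.mulVec_sub, Matrix.mulVec_mulVec]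
    abel
  rw [e]
  refine (nrm_add_le _ _).trans ?_
  rw [nrm_mulVec (wordMat_mem _)]
  push_cast
  linarith

lemma exists_reach_rot : ∃ c : ℕ, ∀ {m : ℕ} (i : Fin (3 + m)) (q : ℍ[ℝ])
    (x : Fin (3 + m) → ℝ), Quaternion.normSq q = 1 → ∑ j, x j ^ 2 = 1 →
    Reach c 1 x ((rot i q).mulVec x) := by
  obtain ⟨c, hc⟩ := exists_unitWalk_mul_close
  refine ⟨c, fun {m} i q x hq hx n => ?_⟩
  have hqs : Quaternion.normSq (star q) = 1 := by rw [Quaternion.normSq_star, hq]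
  obtain ⟨w, hw⟩ := hc n (star q) hqs
  refine ⟨List.ofFn fun k => (i, w k), by simp, ?_⟩
  have hp : Quaternion.normSq (unitWalk w * star q) = 1 := by
    rw [map_mul, normSq_unitWalk, hqs, one_mul]
  have e : unitWalk w = unitWalk w * star q * q := by
    rw [mul_assoc, Quaternion.star_mul_self, hq]
    simp
  rw [wordMat_ofFn]
  nth_rewrite 1 [e]
  rw [rot_mul, ← Matrix.mulVec_mulVec, nrm]
  have h := sum_rot_mulVec_sub_sq_le i hp ((rot i q).mulVec x)
  rw [sum_mulVec_sq (rot_mem_orthogonalGroup i hq), hx, mul_one] at h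
  apply Real.sqrt_le_iff.2 ⟨by positivity, ?_⟩
  simp only [Pi.sub_apply]
  refine h.trans ?_
  have e4 : (1 / 4 : ℝ) ^ n = ((1 / 2) ^ n) ^ 2 := by
    rw [← pow_mul, mul_comm, pow_mul]; norm_num
  rw [e4] at hw
  push_cast
  nlinarith

/-- Two vectors connected by a number of elementary rotations. -/
inductive Conn : ℕ → (Fin (3 + m) → ℝ) → (Fin (3 + m) → ℝ) → Prop
  | zero (x) : Conn 0 x x
  | step {N x y} (i : Fin (3 + m)) (q : ℍ[ℝ]) (hq : Quaternion.normSq q = 1) (h : Conn N x y) :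
      Conn (N + 1) x ((rot i q).mulVec y)

lemma Conn.sum_sq {N : ℕ} {x y : Fin (3 + m) → ℝ} (h : Conn N x y) :
    ∑ i, y i ^ 2 = ∑ i, x i ^ 2 := by
  induction h with
  | zero => rfl
  | step i q hq h ih => rw [sum_mulVec_sq (rot_mem_orthogonalGroup i hq), ih]

lemma Conn.reach {c : ℕ} (hc : ∀ {m : ℕ} (i : Fin (3 + m)) (q : ℍ[ℝ]) (x : Fin (3 + m) → ℝ),
    Quaternion.normSq q = 1 → ∑ j, x j ^ 2 = 1 → Reach c 1 x ((rot i q).mulVec x)) {N : ℕ}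
    {x y : Fin (3 + m) → ℝ} (h : Conn N x y) (hx : ∑ i, x i ^ 2 = 1) : Reach c N x y := by
  induction h with
  | zero => exact Reach.zero c _
  | step i q hq h ih => exact (ih hx).trans (hc i q _ hq (h.sum_sq.trans hx))

lemma Conn.reach_symm {c : ℕ} (hc : ∀ {m : ℕ} (i : Fin (3 + m)) (q : ℍ[ℝ])
    (x : Fin (3 + m) → ℝ), Quaternion.normSq q = 1 → ∑ j, x j ^ 2 = 1 →
      Reach c 1 x ((rot i q).mulVec x)) {N : ℕ}
    {x y : Fin (3 + m) → ℝ} (h : Conn N x y) (hx : ∑ i, x i ^ 2 = 1) : Reach c N y x := by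
  induction h with
  | zero => exact Reach.zero c _
  | step i q hq h ih =>
    rename_i N x y
    have hqs : Quaternion.normSq (star q) = 1 := by rw [Quaternion.normSq_star, hq]
    have h1 := hc i (star q) ((rot i q).mulVec y) hqs
      (((Conn.step i q hq h).sum_sq).trans hx)
    rw [Matrix.mulVec_mulVec, ← rot_mul, Quaternion.star_mul_self, hq] at h1
    rw [show ((1 : ℝ) : ℍ[ℝ]) = 1 from rfl, rot_one, Matrix.one_mulVec] at h1
    rw [add_comm]
    exact h1.trans (ih hx)

/-- A rotation in the plane of the first coordinate and another one. -/
lemma exists_rot_mulVec_eq_zero (i : Fin (3 + m)) (hi : i ≠ Fin.castAdd m 0)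
    (x : Fin (3 + m) → ℝ) : ∃ q : ℍ[ℝ], Quaternion.normSq q = 1 ∧
      (rot i q).mulVec x i = 0 ∧ 0 ≤ (rot i q).mulVec x (Fin.castAdd m 0) ∧
      ∀ j, j ≠ i → j ≠ Fin.castAdd m 0 → (rot i q).mulVec x j = x j := by
  set z : ℂ := ⟨x (Fin.castAdd m 0), x i⟩ with hz
  set φ := z.arg / 2 with hφ
  have hf0 : frame i (Sum.inl 0) = Fin.castAdd m 0 := by
    rw [frame, Equiv.trans_apply, finSumFinEquiv_apply_left,
      Equiv.swap_apply_of_ne_of_ne _ hi.symm]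
    intro h
    have := congrArg Fin.val h
    simp at this
  have hf1 : frame i (Sum.inl 1) = i := by
    rw [frame, Equiv.trans_apply, finSumFinEquiv_apply_left, Equiv.swap_apply_left]
  have hc := Real.cos_sq_add_sin_sq φ
  have hre : ‖z‖ * (Real.cos φ ^ 2 - Real.sin φ ^ 2) = x (Fin.castAdd m 0) := by
    have := Complex.norm_mul_cos_arg z
    rw [show z.arg = 2 * φ by rw [hφ]; ring, Real.cos_two_mul'] at this
    exact this
  have him : ‖z‖ * (2 * Real.sin φ * Real.cos φ) = x i := by
    have := Complex.norm_mul_sin_arg z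
    rw [show z.arg = 2 * φ by rw [hφ]; ring, Real.sin_two_mul] at this
    exact this
  set q : ℍ[ℝ] := ⟨Real.cos φ, 0, 0, -Real.sin φ⟩ with hqdef
  have q0 : q.re = Real.cos φ := rfl
  have q1 : q.imI = 0 := rfl
  have q2 : q.imJ = 0 := rfl
  have q3 : q.imK = -Real.sin φ := rfl
  have hq : Quaternion.normSq q = 1 := by
    rw [Quaternion.normSq_def', q0, q1, q2, q3]
    linarith
  clear_value q
  refine ⟨q, hq, ?_, ?_, ?_⟩
  · have h := rot_mulVec_inl i q x 1
    rw [hf1] at h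
    rw [h]
    simp [Matrix.mulVec, dotProduct, Fin.sum_univ_three, rot3, q0, q1, q2, q3, hf0, hf1]
    rw [← hre, ← him]
    ring
  · have h := rot_mulVec_inl i q x 0
    rw [hf0] at h
    rw [h]
    simp [Matrix.mulVec, dotProduct, Fin.sum_univ_three, rot3, q0, q1, q2, q3, hf0, hf1]
    rw [← hre, ← him]
    have : 0 ≤ ‖z‖ * (Real.cos φ ^ 2 + Real.sin φ ^ 2) ^ 2 := by positivity
    linarith
  · intro j hji hj0
    obtain ⟨s, rfl⟩ := (frame i).surjective j
    rcases s with k | k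
    · fin_cases k
      · exact absurd hf0 hj0
      · exact absurd hf1 hji
      · have h := rot_mulVec_inl i q x 2
        refine h.trans ?_
        simp [Matrix.mulVec, dotProduct, Fin.sum_univ_three, rot3, q0, q1, q2, q3]
    · exact rot_mulVec_inr i q x k

lemma exists_conn_zero_on (S : Finset (Fin (3 + m))) (hS : Fin.castAdd m 0 ∉ S)
    (x : Fin (3 + m) → ℝ) : ∃ y, Conn S.card x y ∧ (∀ i ∈ S, y i = 0) ∧
      (S.Nonempty → 0 ≤ y (Fin.castAdd m 0)) := by
  induction S using Finset.induction_on with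
  | empty => exact ⟨x, Conn.zero x, by simp, by simp⟩
  | insert i S hi ih =>
    rw [Finset.mem_insert, not_or] at hS
    obtain ⟨y, hy, hyS, -⟩ := ih hS.2
    obtain ⟨q, hq, h1, h2, h3⟩ := exists_rot_mulVec_eq_zero i (Ne.symm hS.1) y
    refine ⟨(rot i q).mulVec y, ?_, ?_, fun _ => h2⟩
    · rw [Finset.card_insert_of_notMem hi]
      exact Conn.step i q hq hy
    · intro j hj
      rcases Finset.mem_insert.1 hj with rfl | hj
      · exact h1
      · rw [h3 j (fun h => hi (h ▸ hj)) (fun h => hS.2 (h ▸ hj)), hyS j hj]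

lemma conn_single (x : Fin (3 + m) → ℝ) (hx : ∑ i, x i ^ 2 = 1) :
    Conn (2 + m) x (Pi.single (Fin.castAdd m 0) 1) := by
  obtain ⟨y, hy, h0, hpos⟩ := exists_conn_zero_on (Finset.univ.erase (Fin.castAdd m 0))
    (by simp) x
  have hcard : (Finset.univ.erase (Fin.castAdd m 0 : Fin (3 + m))).card = 2 + m := by
    rw [Finset.card_erase_of_mem (Finset.mem_univ _), Finset.card_univ, Fintype.card_fin]
    omega
  have hne := hpos (Finset.card_pos.1 (by omega))
  have hy0 : ∀ i, i ≠ Fin.castAdd m 0 → y i = 0 := fun i hi => h0 i (by simp [hi])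
  have hs := hy.sum_sq.trans hx
  rw [Finset.sum_eq_single (Fin.castAdd m 0) (fun i _ hi => by rw [hy0 i hi]; simp) (by simp)]
    at hs
  have h1 : y (Fin.castAdd m 0) = 1 := by nlinarith
  have hyy : y = Pi.single (Fin.castAdd m 0) 1 := by
    ext i
    by_cases hi : i = Fin.castAdd m 0
    · subst hi; rw [h1, Pi.single_eq_same]
    · rw [hy0 i hi, Pi.single_eq_of_ne hi]
  rw [hcard, hyy] at hy
  exact hy

lemma exists_reach : ∃ c : ℕ, ∀ {m : ℕ} (x y : Fin (3 + m) → ℝ), ∑ i, x i ^ 2 = 1 →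
    ∑ i, y i ^ 2 = 1 → Reach c (2 + m + (2 + m)) x y := by
  obtain ⟨c, hc⟩ := exists_reach_rot
  exact ⟨c, fun x y hx hy =>
    ((conn_single x hx).reach hc hx).trans ((conn_single y hy).reach_symm hc hy)⟩

end BoxCounting

namespace BoxCounting

/-! ### Counting boxes -/

lemma card_le_meshCount {d : ℕ} {δ : ℝ} (hδ : 0 < δ) {E : Set (Fin d → ℝ)} (hE : E.Finite)
    {ι : Type*} [Fintype ι] (f : ι → Fin d → ℝ) (hf : ∀ t, f t ∈ E)
    (hinj : Function.Injective fun t i => ⌊f t i / δ⌋) : Fintype.card ι ≤ meshCount d δ E := by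
  have hset : {a : Fin d → ℤ | ∃ x ∈ E, ∀ i, (a i : ℝ) * δ ≤ x i ∧ x i < ((a i : ℝ) + 1) * δ} =
      (fun x i => ⌊x i / δ⌋) '' E := by
    ext a
    refine exists_congr fun x => and_congr_right fun _ => ?_
    rw [funext_iff]
    refine forall_congr' fun i => ?_
    rw [Int.floor_eq_iff, le_div_iff₀ hδ, div_lt_iff₀ hδ]
  rw [meshCount, hset, ← Nat.card_eq_fintype_card, ← Set.ncard_univ,
    ← Set.ncard_image_of_injective _ hinj]
  refine Set.ncard_le_ncard ?_ (hE.image _)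
  rintro _ ⟨t, _, rfl⟩
  exact ⟨f t, hf t, rfl⟩

/-- A point of the sphere with prescribed coordinates except one. -/
noncomputable def spherePoint {d : ℕ} (z : Fin d) (s : {j // j ≠ z} → ℝ) (j : Fin d) : ℝ :=
  if h : j = z then √(1 - ∑ i, s i ^ 2) else s ⟨j, h⟩

lemma sum_spherePoint_sq {d : ℕ} (z : Fin d) {s : {j // j ≠ z} → ℝ} (hs : ∑ i, s i ^ 2 ≤ 1) :
    ∑ j, spherePoint z s j ^ 2 = 1 := by
  rw [Fintype.sum_eq_add_sum_subtype_ne _ z]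
  have h : ∀ i : {j // j ≠ z}, spherePoint z s i = s i := fun i => dif_neg i.2
  simp only [h]
  rw [spherePoint, dif_pos rfl, Real.sq_sqrt (by linarith)]
  ring

lemma floor_grid_injective {a b η δ : ℝ} (hδ : 0 < δ) (hη : δ ≤ η) {s t : ℕ}
    (ha : |a - 4 * η * s| ≤ η) (hb : |b - 4 * η * t| ≤ η) (h : ⌊a / δ⌋ = ⌊b / δ⌋) : s = t := by
  have h1 := Int.abs_sub_lt_one_of_floor_eq_floor h
  rw [← sub_div, abs_div, abs_of_pos hδ, div_lt_one hδ] at h1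
  by_contra hne
  have h2 : (1 : ℝ) ≤ |(s : ℝ) - t| := by
    have : (1 : ℤ) ≤ |(s : ℤ) - t| := Int.one_le_abs (by omega)
    exact_mod_cast this
  have h3 : 4 * η ≤ |4 * η * s - 4 * η * t| := by
    rw [← mul_sub, abs_mul, abs_of_pos (by linarith)]
    nlinarith
  have h4 : |4 * η * s - 4 * η * t| ≤ |a - 4 * η * s| + |a - b| + |b - 4 * η * t| := by
    have e : 4 * η * s - 4 * η * t = -(a - 4 * η * s) + (a - b) + (b - 4 * η * t) := by ring
    rw [e]
    refine (abs_add_le _ _).trans (add_le_add_left ((abs_add_le _ _).trans ?_) _)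
    rw [abs_neg]
  linarith

/-- A finite set which is dense in the sphere at scale `η` meets many boxes. -/
lemma pow_le_meshCount {D : ℕ} (hD : 0 < D) {δ η : ℝ} (hδ : 0 < δ) (hη : δ ≤ η)
    {E : Set (Fin (D + 1) → ℝ)} (hE : E.Finite)
    (hdense : ∀ y : Fin (D + 1) → ℝ, ∑ i, y i ^ 2 = 1 → ∃ x ∈ E, ∀ i, |x i - y i| ≤ η) :
    ⌊1 / (4 * η * D)⌋₊ ^ D ≤ meshCount (D + 1) δ E := by
  set T := ⌊1 / (4 * η * D)⌋₊ with hT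
  have hη0 : 0 < η := hδ.trans_le hη
  have hDr : (1 : ℝ) ≤ D := by exact_mod_cast hD
  have hTle : 4 * η * T * D ≤ 1 := by
    have := Nat.floor_le (show 0 ≤ 1 / (4 * η * D) by positivity)
    rw [← hT, le_div_iff₀ (by positivity)] at this
    linarith
  have hcard : Fintype.card {j : Fin (D + 1) // j ≠ 0} = D := by
    rw [Fintype.card_subtype_compl, Fintype.card_fin, Fintype.card_subtype_eq]; rfl
  have hsum : ∀ t : {j : Fin (D + 1) // j ≠ 0} → Fin T,
      ∑ i, (4 * η * (t i : ℕ)) ^ 2 ≤ 1 := by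
    intro t
    calc ∑ i, (4 * η * (t i : ℕ)) ^ 2 ≤ ∑ _i : {j : Fin (D + 1) // j ≠ 0}, (4 * η * T) ^ 2 := by
          refine Finset.sum_le_sum fun i _ => ?_
          gcongr
          exact (t i).2.le
      _ = D * (4 * η * T) ^ 2 := by
          rw [Finset.sum_const, Finset.card_univ, hcard, nsmul_eq_mul]
      _ ≤ (4 * η * T * D) ^ 2 := by
          rw [mul_pow _ (D : ℝ), mul_comm]
          gcongr
          nlinarith
      _ ≤ 1 := pow_le_one₀ (by positivity) hTle
  choose f hfE hf using fun t : {j : Fin (D + 1) // j ≠ 0} → Fin T =>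
    hdense (spherePoint 0 fun i => 4 * η * (t i : ℕ)) (sum_spherePoint_sq 0 (hsum t))
  have h := card_le_meshCount hδ hE f hfE (by
    intro t t' htt
    ext i
    have h1 := hf t i
    have h2 := hf t' i
    rw [spherePoint, dif_neg i.2] at h1 h2
    exact floor_grid_injective hδ hη h1 h2 (congrFun htt i))
  rw [Fintype.card_fun, Fintype.card_fin, hcard] at h
  exact h

lemma div_pow_le_meshCount {d D : ℕ} (hd : d = D + 1) (hD : 0 < D) {δ η : ℝ} (hδ : 0 < δ)
    (hη : δ ≤ η) {E : Set (Fin d → ℝ)} (hE : E.Finite) (hne : E.Nonempty)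
    (hdense : ∀ y : Fin d → ℝ, ∑ i, y i ^ 2 = 1 → ∃ x ∈ E, ∀ i, |x i - y i| ≤ η) :
    (1 / (8 * η * D)) ^ D ≤ (meshCount d δ E : ℝ) := by
  subst hd
  have hη0 : 0 < η := hδ.trans_le hη
  have hDr : (0 : ℝ) < D := by exact_mod_cast hD
  have h := pow_le_meshCount hD hδ hη hE hdense
  have hu : 1 / (8 * η * D) = 1 / (4 * η * D) / 2 := by field_simp; norm_num
  rw [hu]
  set u := 1 / (4 * η * D) with hu'
  have hu0 : 0 < u := by positivity
  rcases lt_or_ge u 1 with h1 | h1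
  · obtain ⟨x, hx⟩ := hne
    have h2 := card_le_meshCount hδ hE (fun _ : Unit => x) (fun _ => hx)
      (Function.injective_of_subsingleton _)
    rw [Fintype.card_unit] at h2
    calc (u / 2) ^ D ≤ 1 := pow_le_one₀ (by positivity) (by linarith)
      _ ≤ _ := by exact_mod_cast h2
  · calc (u / 2) ^ D ≤ (⌊u⌋₊ : ℝ) ^ D := by
          gcongr
          have h3 := Nat.lt_floor_add_one u
          have h4 : (1 : ℝ) ≤ ⌊u⌋₊ := by exact_mod_cast Nat.one_le_floor_iff u |>.2 h1
          linarith
      _ ≤ _ := by exact_mod_cast h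

lemma exists_ofFn_eq {α : Type*} {l : List α} {n : ℕ} (h : l.length = n) :
    ∃ f : Fin n → α, List.ofFn f = l := by
  subst h
  exact ⟨l.get, List.ofFn_get l⟩

variable {m : ℕ}

lemma exists_blocks {M k : ℕ} (e : (Fin M → Fin (3 + m) × Fin 6) ≃ Fin k) (n : ℕ) :
    ∀ l : List (Fin (3 + m) × Fin 6), l.length = n * M → ∃ w : Fin n → Fin k, ∀ x,
      (List.ofFn w).foldr (fun i v => (wordMat (List.ofFn (e.symm i))).mulVec v) x =
        (wordMat l).mulVec x := by
  induction n with
  | zero =>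
    intro l hl
    rw [zero_mul, List.length_eq_zero_iff] at hl
    subst hl
    exact ⟨Fin.elim0, fun x => by simp [wordMat]⟩
  | succ n ih =>
    intro l hl
    rw [add_mul, one_mul] at hl
    obtain ⟨w, hw⟩ := ih (l.drop M) (by rw [List.length_drop]; omega)
    obtain ⟨f, hf⟩ := exists_ofFn_eq (l := l.take M) (n := M)
      (by rw [List.length_take]; omega)
    refine ⟨Fin.cons (e f) w, fun x => ?_⟩
    rw [List.ofFn_succ]
    simp only [Fin.cons_zero, Fin.cons_succ, List.foldr_cons]
    rw [hw, Equiv.symm_apply_apply, hf, Matrix.mulVec_mulVec, ← wordMat_append,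
      List.take_append_drop]

/-- The boxes met by a set which is exponentially dense in the sphere. -/
lemma min_le_meshCount {d D : ℕ} (hd : d = D + 1) (hD : 0 < D) {n : ℕ} (hn : 1 ≤ n) {δ : ℝ}
    (hδ : 0 < δ) {E : Set (Fin d → ℝ)} (hE : E.Finite) (hne : E.Nonempty)
    (hdense : ∀ y : Fin d → ℝ, ∑ i, y i ^ 2 = 1 →
      ∃ x ∈ E, ∀ i, |x i - y i| ≤ (1 / (16 * (D : ℝ))) ^ n) :
    min ((1 + (1 / (8 * (D : ℝ))) ^ D) ^ n)
      ((1 / (8 * (D : ℝ))) ^ D * δ ^ (-((d : ℝ) - 1))) ≤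
      (meshCount d δ E : ℝ) := by
  have hDr : (1 : ℝ) ≤ D := by exact_mod_cast hD
  rcases le_total ((1 / (16 * (D : ℝ))) ^ n) δ with h | h
  · refine (min_le_right _ _).trans ?_
    refine le_trans (le_of_eq ?_) (div_pow_le_meshCount hd hD hδ le_rfl hE hne fun y hy => ?_)
    · have e : -((d : ℝ) - 1) = -(D : ℝ) := by rw [hd]; push_cast; ring
      rw [e, Real.rpow_neg hδ.le, Real.rpow_natCast, ← inv_pow, ← mul_pow]
      congr 1
      field_simp
    · obtain ⟨x, hx, h'⟩ := hdense y hy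
      exact ⟨x, hx, fun i => (h' i).trans h⟩
  · refine (min_le_left _ _).trans ?_
    refine le_trans ?_ (div_pow_le_meshCount hd hD hδ h hE hne hdense)
    have h1 : (2 : ℝ) ^ n ≤ 1 / (8 * (1 / (16 * (D : ℝ))) ^ n * D) := by
      have e : 1 / (8 * (1 / (16 * (D : ℝ))) ^ n * D) = (16 * (D : ℝ)) ^ n / (8 * D) := by
        rw [one_div_pow]
        field_simp
      rw [e, le_div_iff₀ (by positivity)]
      calc (2 : ℝ) ^ n * (8 * D) ≤ 2 ^ n * (8 * D) ^ n := by
            gcongr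
            exact le_self_pow₀ (by linarith) (by omega)
        _ = (16 * (D : ℝ)) ^ n := by rw [← mul_pow]; congr 1; ring
    have h2 : (1 / (8 * (D : ℝ))) ^ D ≤ 1 :=
      pow_le_one₀ (by positivity) (by rw [div_le_one (by positivity)]; linarith)
    calc (1 + (1 / (8 * (D : ℝ))) ^ D) ^ n ≤ 2 ^ n := by
          gcongr
          linarith
      _ ≤ (2 ^ n) ^ D := le_self_pow₀ (one_le_pow₀ (by norm_num)) hD.ne'
      _ ≤ _ := by gcongr

/-- Words of a suitable length come exponentially close to any point of the sphere. -/
lemma exists_words_dense (m : ℕ) : ∃ M : ℕ, ∀ n, 1 ≤ n → ∀ x y : Fin (3 + m) → ℝ,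
    ∑ i, x i ^ 2 = 1 → ∑ i, y i ^ 2 = 1 → ∃ l : List (Fin (3 + m) × Fin 6),
      l.length = n * M ∧
        ∀ i, |(wordMat l).mulVec x i - y i| ≤ (1 / (16 * ((2 + m : ℕ) : ℝ))) ^ n := by
  obtain ⟨c, hc⟩ := exists_reach
  set N := 2 + m + (2 + m) with hN
  have hNr : (1 : ℝ) ≤ N := by exact_mod_cast (by omega : 1 ≤ N)
  obtain ⟨a, ha⟩ := exists_pow_lt_of_lt_one
    (show (0 : ℝ) < 1 / (16 * ((2 + m : ℕ) : ℝ)) / (N * 2) by positivity)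
    (show (1 / 2 : ℝ) < 1 by norm_num)
  rw [lt_div_iff₀ (by positivity)] at ha
  refine ⟨N * (c * a), fun n hn x y hx hy => ?_⟩
  obtain ⟨l, hl, h⟩ := hc x y hx hy (a * n)
  refine ⟨l, by rw [hl]; ring, fun i => ?_⟩
  refine ((abs_apply_le_nrm _ i).trans h).trans ?_
  calc (N : ℝ) * (2 * (1 / 2) ^ (a * n)) = ((1 / 2) ^ a) ^ n * (N * 2) := by rw [pow_mul]; ring
    _ ≤ ((1 / 2) ^ a) ^ n * (N * 2) ^ n := by
        gcongr
        exact le_self_pow₀ (by linarith) (by omega)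
    _ = ((1 / 2) ^ a * (N * 2)) ^ n := (mul_pow _ _ _).symm
    _ ≤ _ := by gcongr

end BoxCounting

/-- For `d ≥ 3` there are finitely many rotations `g₁,…,g_k ∈ SO(d)` and `ε > 0` such that
for every unit vector `x`, every `n` and every `δ > 0`,
`N_δ(Gⁿ(x)) ≥ min{(1+ε)ⁿ, ε δ^{-(d-1)}}`, where
`Gⁿ(x) = {g_{i₁}(g_{i₂}(⋯ g_{i_n}(x)⋯)) : (i₁,…,i_n) ∈ {1,…,k}ⁿ}`. -/
theorem spectral_gap_box_counting (d : ℕ) (hd : 3 ≤ d) :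
    ∃ (k : ℕ) (g : Fin k → Matrix (Fin d) (Fin d) ℝ) (ε : ℝ),
      0 < k ∧ 0 < ε ∧
      (∀ i, g i ∈ Matrix.orthogonalGroup (Fin d) ℝ ∧ (g i).det = 1) ∧
      ∀ x : Fin d → ℝ, ∑ i, x i ^ 2 = 1 →
        ∀ n : ℕ, ∀ δ : ℝ, 0 < δ →
          min ((1 + ε) ^ n) (ε * δ ^ (-((d : ℝ) - 1))) ≤
            (meshCount d δ
              {y | ∃ w : Fin n → Fin k,
                y = (List.ofFn w).foldr (fun i v => (g i).mulVec v) x} : ℝ) := by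
  obtain ⟨m, rfl⟩ := Nat.exists_eq_add_of_le hd
  obtain ⟨M, hM⟩ := BoxCounting.exists_words_dense m
  let e := Fintype.equivFin (Fin M → Fin (3 + m) × Fin 6)
  have : Nonempty (Fin (3 + m)) := ⟨Fin.castAdd m 0⟩
  have hk : 0 < Fintype.card (Fin M → Fin (3 + m) × Fin 6) := Fintype.card_pos
  refine ⟨_, fun i => BoxCounting.wordMat (List.ofFn (e.symm i)),
    (1 / (8 * ((2 + m : ℕ) : ℝ))) ^ (2 + m), hk, by positivity,
    fun i => ⟨BoxCounting.wordMat_mem _, BoxCounting.det_wordMat _⟩, fun x hx n δ hδ => ?_⟩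
  set E : Set (Fin (3 + m) → ℝ) :=
    {y | ∃ w : Fin n → Fin (Fintype.card (Fin M → Fin (3 + m) × Fin 6)),
      y = (List.ofFn w).foldr
        (fun i v => (BoxCounting.wordMat (List.ofFn (e.symm i))).mulVec v) x}
  have hfin : E.Finite := by
    refine (Set.finite_range fun w : Fin n → Fin (Fintype.card (Fin M → Fin (3 + m) × Fin 6)) =>
      (List.ofFn w).foldr
        (fun i v => (BoxCounting.wordMat (List.ofFn (e.symm i))).mulVec v) x).subset ?_
    rintro y ⟨w, rfl⟩
    exact ⟨w, rfl⟩
  have hne : E.Nonempty := ⟨_, fun _ => ⟨0, hk⟩, rfl⟩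
  rcases Nat.eq_zero_or_pos n with hn | hn
  · obtain ⟨y, hy⟩ := hne
    have h := BoxCounting.card_le_meshCount hδ hfin (fun _ : Unit => y) (fun _ => hy)
      (Function.injective_of_subsingleton _)
    rw [Fintype.card_unit] at h
    refine (min_le_left _ _).trans ?_
    rw [hn, pow_zero]
    exact_mod_cast h
  · refine BoxCounting.min_le_meshCount (D := 2 + m) (by omega) (by omega) hn hδ hfin hne
      fun y hy => ?_
    obtain ⟨l, hl, h⟩ := hM n hn x y hx hy
    obtain ⟨w, hw⟩ := BoxCounting.exists_blocks e n l hl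
    exact ⟨_, ⟨w, (hw x).symm⟩, h⟩
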